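/- Let n ≥ 3. For every c < −(n−2)/4 there exists a positive function u ∈ C^∞(ℝⁿ \ {0}) satisfying Δu(x) + (c/|x|²) u(x) + u(x)^{(n+2)/(n−2)} = 0 for all x ∈ ℝⁿ \ {0} which is not radially symmetric about the origin. Moreover, for every positive integer k there exists cₖ < 0 such that for every c < cₖ there exist at least k distinct such non-radial solutions. -/

import Mathlib

open scoped BigOperators

/-- The Euclidean Laplacian of `u : ℝⁿ → ℝ` at `x`, as the sum of the pure second
derivatives in the standard coordinate directions. -/
noncomputable def eLaplacian {n : ℕ} (u : EuclideanSpace ℝ (Fin n) → ℝ)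
    (x : EuclideanSpace ℝ (Fin n)) : ℝ :=
  ∑ i : Fin n, iteratedFDeriv ℝ 2 u x ![EuclideanSpace.single i 1, EuclideanSpace.single i 1]

/-- `u` is a positive smooth, non-radial solution of `Δu + (c/|x|²) u + u^{(n+2)/(n-2)} = 0`
on `ℝⁿ \ {0}`. -/
def IsNonRadialSolution (n : ℕ) (c : ℝ) (u : EuclideanSpace ℝ (Fin n) → ℝ) : Prop :=
  ContDiffOn ℝ (⊤ : ℕ∞) u {x | x ≠ 0} ∧
  (∀ x : EuclideanSpace ℝ (Fin n), x ≠ 0 → 0 < u x) ∧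
  (∀ x : EuclideanSpace ℝ (Fin n), x ≠ 0 →
    eLaplacian u x + (c / ‖x‖ ^ 2) * u x
      + u x ^ (((n : ℝ) + 2) / ((n : ℝ) - 2)) = 0) ∧
  ¬ (∀ x y : EuclideanSpace ℝ (Fin n), x ≠ 0 → y ≠ 0 → ‖x‖ = ‖y‖ → u x = u y)

section ProfileEquation

open Set Filter Topology MeasureTheory
open scoped InnerProductSpace

theorem exists_weakly_convergent_subseq {H : Type*} [NormedAddCommGroup H] [InnerProductSpace ℝ H]
    [CompleteSpace H] [TopologicalSpace.SeparableSpace H] {x : ℕ → H} {R : ℝ}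
    (hx : ∀ n, ‖x n‖ ≤ R) :
    ∃ (y : H) (φ : ℕ → ℕ), StrictMono φ ∧
      ∀ z, Tendsto (fun n => ⟪x (φ n), z⟫_ℝ) atTop (𝓝 ⟪y, z⟫_ℝ) := by
  have hc := WeakDual.isSeqCompact_closedBall ℝ H (0 : StrongDual ℝ H) R
  obtain ⟨l, -, φ, hφ, hl⟩ := hc
    (x := fun n => StrongDual.toWeakDual (InnerProductSpace.toDual ℝ H (x n)))
    (fun n => by simpa using hx n)
  refine ⟨(InnerProductSpace.toDual ℝ H).symm (WeakDual.toStrongDual l), φ, hφ, fun z => ?_⟩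
  have := ((WeakDual.eval_continuous z).tendsto l).comp hl
  simpa [Function.comp_def] using this

theorem hasDerivAt_posPart_rpow {q : ℝ} (hq : 1 < q) (x : ℝ) :
    HasDerivAt (fun y : ℝ => (max y 0) ^ q) (q * (max x 0) ^ (q - 1)) x := by
  rcases lt_trichotomy x 0 with h | h | h
  · have h1 : (fun y : ℝ => (max y 0) ^ q) =ᶠ[𝓝 x] fun _ => 0 := by
      filter_upwards [Iio_mem_nhds h] with y hy
      rw [max_eq_right (le_of_lt hy), Real.zero_rpow (by linarith)]
    rw [max_eq_right h.le, Real.zero_rpow (by linarith), mul_zero]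
    exact (hasDerivAt_const x 0).congr_of_eventuallyEq h1
  · subst h
    rw [max_self, Real.zero_rpow (by linarith), mul_zero]
    have h1 := (Real.hasDerivAt_rpow_const (x := 0) (p := q) (Or.inr hq.le))
    rw [Real.zero_rpow (by linarith : q - 1 ≠ 0), mul_zero] at h1
    rw [hasDerivAt_iff_isLittleO_nhds_zero] at h1 ⊢
    refine (Asymptotics.IsBigO.of_bound 1 ?_).trans_isLittleO h1
    filter_upwards with y
    simp only [zero_add, max_self, Real.zero_rpow (by linarith : q ≠ 0), smul_zero, sub_zero,
      one_mul]
    rcases le_total y 0 with hy | hy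
    · rw [max_eq_right hy, Real.zero_rpow (by linarith)]; simp
    · rw [max_eq_left hy]
  · have h1 : (fun y : ℝ => (max y 0) ^ q) =ᶠ[𝓝 x] fun y => y ^ q := by
      filter_upwards [Ioi_mem_nhds h] with y hy
      rw [max_eq_left (le_of_lt hy)]
    rw [max_eq_left h.le]
    exact (Real.hasDerivAt_rpow_const (Or.inl h.ne')).congr_of_eventuallyEq h1

section Variational

variable {H : Type*} [NormedAddCommGroup H] [InnerProductSpace ℝ H] {Ω : Type*}

/-- The function on `Ω` represented by a constant `x.1` and a vector `x.2` of a Hilbert space with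
evaluation vectors `κ ω`. -/
noncomputable def represented (κ : Ω → H) (x : ℝ × H) (ω : Ω) : ℝ := x.1 + ⟪κ ω, x.2⟫_ℝ

/-- The quadratic energy of a represented function. -/
noncomputable def energy [MeasurableSpace Ω] (W : Measure Ω) (κ : Ω → H) (lam : ℝ) (x : ℝ × H) :
    ℝ := ‖x.2‖ ^ 2 + lam * ∫ ω, represented κ x ω ^ 2 ∂W

/-- The integral of the `q`-th power of the positive part of a represented function. -/
noncomputable def posMass [MeasurableSpace Ω] (W : Measure Ω) (κ : Ω → H) (q : ℝ) (x : ℝ × H) :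
    ℝ := ∫ ω, (max (represented κ x ω) 0) ^ q ∂W

theorem represented_add_smul (κ : Ω → H) (x y : ℝ × H) (t : ℝ) (ω : Ω) :
    represented κ (x + t • y) ω = represented κ x ω + t * represented κ y ω := by
  simp [represented, inner_add_right, inner_smul_right]; ring

theorem represented_smul (κ : Ω → H) (x : ℝ × H) (t : ℝ) (ω : Ω) :
    represented κ (t • x) ω = t * represented κ x ω := by
  simp [represented, inner_smul_right]; ring

theorem represented_const (κ : Ω → H) (b : ℝ) (ω : Ω) : represented κ (b, (0 : H)) ω = b := by
  simp [represented]

/-- Evaluation vectors with a majorant `G` in `L^q`. -/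
structure IsAdmissible [MeasurableSpace Ω] (W : Measure Ω) (κ : Ω → H) (G : Ω → ℝ) (q : ℝ) :
    Prop where
  norm_le : ∀ ω, ‖κ ω‖ ≤ G ω
  one_le : ∀ ω, 1 ≤ G ω
  measurable_majorant : Measurable G
  integrable : Integrable (fun ω => G ω ^ q) W
  measurable : ∀ h, Measurable fun ω => ⟪κ ω, h⟫_ℝ
  two_lt : 2 < q

variable [MeasurableSpace Ω] {W : Measure Ω} {κ : Ω → H} {G : Ω → ℝ} {q lam : ℝ}

namespace IsAdmissible

theorem abs_represented_le (hA : IsAdmissible W κ G q) (x : ℝ × H) (ω : Ω) :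
    |represented κ x ω| ≤ (|x.1| + ‖x.2‖) * G ω := by
  have h1 := abs_real_inner_le_norm (κ ω) x.2
  have h2 := mul_le_mul_of_nonneg_right (hA.norm_le ω) (norm_nonneg x.2)
  have h3 := mul_le_mul_of_nonneg_left (hA.one_le ω) (abs_nonneg x.1)
  calc |represented κ x ω| ≤ |x.1| + |⟪κ ω, x.2⟫_ℝ| := abs_add_le _ _
    _ ≤ _ := by nlinarith

theorem measurable_represented (hA : IsAdmissible W κ G q) (x : ℝ × H) :
    Measurable (represented κ x) := (hA.measurable x.2).const_add x.1

theorem sq_le (hA : IsAdmissible W κ G q) (ω : Ω) : G ω ^ 2 ≤ G ω ^ q := by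
  rw [← Real.rpow_natCast]
  exact Real.rpow_le_rpow_of_exponent_le (hA.one_le ω) (by exact_mod_cast hA.two_lt.le)

theorem integrable_majorant_sq (hA : IsAdmissible W κ G q) : Integrable (fun ω => G ω ^ 2) W := by
  refine hA.integrable.mono (hA.measurable_majorant.pow_const 2).aestronglyMeasurable ?_
  filter_upwards with ω
  have := hA.one_le ω
  rw [Real.norm_of_nonneg (by positivity), Real.norm_of_nonneg (by positivity)]
  exact hA.sq_le ω

theorem integrable_mul (hA : IsAdmissible W κ G q) (x y : ℝ × H) :
    Integrable (fun ω => represented κ x ω * represented κ y ω) W := by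
  refine (hA.integrable_majorant_sq.const_mul ((|x.1| + ‖x.2‖) * (|y.1| + ‖y.2‖))).mono'
    ((hA.measurable_represented x).mul (hA.measurable_represented y)).aestronglyMeasurable ?_
  filter_upwards with ω
  rw [norm_mul, Real.norm_eq_abs, Real.norm_eq_abs]
  have := mul_le_mul (hA.abs_represented_le x ω) (hA.abs_represented_le y ω) (abs_nonneg _)
    ((abs_nonneg _).trans (hA.abs_represented_le x ω))
  linarith

theorem posPart_rpow_le (hA : IsAdmissible W κ G q) {r R : ℝ} (hr : 0 ≤ r) {x : ℝ × H}
    (hx : |x.1| + ‖x.2‖ ≤ R) (ω : Ω) :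
    (max (represented κ x ω) 0) ^ r ≤ R ^ r * G ω ^ r := by
  have hR : 0 ≤ R := le_trans (by positivity) hx
  have hG : 0 ≤ G ω := zero_le_one.trans (hA.one_le ω)
  rw [← Real.mul_rpow hR hG]
  refine Real.rpow_le_rpow (le_max_right _ _) (max_le ?_ (by positivity)) hr
  exact (le_abs_self _).trans ((hA.abs_represented_le x ω).trans
    (mul_le_mul_of_nonneg_right hx hG))

theorem tendsto_integral_sq (hA : IsAdmissible W κ G q) {x : ℕ → ℝ × H} {y : ℝ × H} {R : ℝ}
    (hR : ∀ n, |(x n).1| + ‖(x n).2‖ ≤ R)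
    (hx : ∀ ω, Tendsto (fun n => represented κ (x n) ω) atTop (𝓝 (represented κ y ω))) :
    Tendsto (fun n => ∫ ω, represented κ (x n) ω ^ 2 ∂W) atTop
      (𝓝 (∫ ω, represented κ y ω ^ 2 ∂W)) := by
  refine tendsto_integral_of_dominated_convergence (fun ω => R ^ 2 * G ω ^ 2)
    (fun n => ((hA.measurable_represented _).pow_const 2).aestronglyMeasurable)
    (hA.integrable_majorant_sq.const_mul _) (fun n => ?_) ?_
  · filter_upwards with ω
    have h1 := (hA.abs_represented_le (x n) ω).trans
      (mul_le_mul_of_nonneg_right (hR n) (zero_le_one.trans (hA.one_le ω)))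
    rw [norm_pow, Real.norm_eq_abs, ← mul_pow]
    exact pow_le_pow_left₀ (abs_nonneg _) h1 2
  · filter_upwards with ω
    exact (hx ω).pow 2

theorem tendsto_posMass (hA : IsAdmissible W κ G q) {x : ℕ → ℝ × H} {y : ℝ × H} {R : ℝ}
    (hR : ∀ n, |(x n).1| + ‖(x n).2‖ ≤ R)
    (hx : ∀ ω, Tendsto (fun n => represented κ (x n) ω) atTop (𝓝 (represented κ y ω))) :
    Tendsto (fun n => posMass W κ q (x n)) atTop (𝓝 (posMass W κ q y)) := by
  have hq := hA.two_lt
  refine tendsto_integral_of_dominated_convergence (fun ω => R ^ q * G ω ^ q)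
    (fun n =>
      (((hA.measurable_represented _).max measurable_const).pow_const q).aestronglyMeasurable)
    (hA.integrable.const_mul _) (fun n => ?_) ?_
  · filter_upwards with ω
    rw [Real.norm_of_nonneg (by positivity)]
    exact hA.posPart_rpow_le (by linarith) (hR n) ω
  · filter_upwards with ω
    exact ((hx ω).max tendsto_const_nhds).rpow_const (Or.inr (by linarith))

theorem energy_add_smul (hA : IsAdmissible W κ G q) (x y : ℝ × H) (t : ℝ) :
    energy W κ lam (x + t • y) = energy W κ lam x
      + t * (2 * (⟪x.2, y.2⟫_ℝ + lam * ∫ ω, represented κ x ω * represented κ y ω ∂W))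
      + t ^ 2 * energy W κ lam y := by
  have h1 : ∫ ω, represented κ (x + t • y) ω ^ 2 ∂W = ∫ ω, represented κ x ω ^ 2 ∂W
      + 2 * t * ∫ ω, represented κ x ω * represented κ y ω ∂W
      + t ^ 2 * ∫ ω, represented κ y ω ^ 2 ∂W := by
    have hi := hA.integrable_mul x x
    have hj := hA.integrable_mul x y
    have hk := hA.integrable_mul y y
    simp only [← pow_two] at hi hk
    have hl : ∫ ω, represented κ (x + t • y) ω ^ 2 ∂W = ∫ ω, ((represented κ x ω ^ 2
        + 2 * t * (represented κ x ω * represented κ y ω)) + t ^ 2 * represented κ y ω ^ 2) ∂W := by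
      congr 1; ext ω
      rw [represented_add_smul]; ring
    have hij : Integrable (fun ω => represented κ x ω ^ 2
        + 2 * t * (represented κ x ω * represented κ y ω)) W := hi.add (hj.const_mul _)
    rw [hl, integral_add hij (hk.const_mul _),
      integral_add hi (hj.const_mul _), integral_const_mul, integral_const_mul]
  have h2 : ‖(x + t • y).2‖ ^ 2 = ‖x.2‖ ^ 2 + 2 * t * ⟪x.2, y.2⟫_ℝ + t ^ 2 * ‖y.2‖ ^ 2 := by
    rw [Prod.snd_add, Prod.smul_snd, norm_add_sq_real, inner_smul_right, norm_smul, mul_pow,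
      Real.norm_eq_abs, sq_abs]; ring
  rw [energy, h1, h2, energy, energy]; ring

theorem energy_smul (x : ℝ × H) (t : ℝ) :
    energy W κ lam (t • x) = t ^ 2 * energy W κ lam x := by
  simp only [energy, represented_smul, mul_pow, integral_const_mul, Prod.smul_snd, norm_smul,
    Real.norm_eq_abs, sq_abs]; ring

theorem posMass_smul (x : ℝ × H) {t : ℝ} (ht : 0 ≤ t) :
    posMass W κ q (t • x) = t ^ q * posMass W κ q x := by
  simp only [posMass, represented_smul]
  rw [← integral_const_mul]
  congr 1; ext ω
  rw [← Real.mul_rpow ht (le_max_right _ _), mul_max_of_nonneg _ _ ht, mul_zero]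

theorem exists_bound [IsFiniteMeasure W] (hW : W ≠ 0) (hA : IsAdmissible W κ G q)
    (hlam : 0 < lam) : ∃ R, ∀ x, energy W κ lam x ≤ 1 → |x.1| + ‖x.2‖ ≤ R := by
  set A := W.real univ
  have hA0 : 0 < A := by
    simp [A, measureReal_def, ENNReal.toReal_pos_iff, hW, pos_iff_ne_zero]
  set g := ∫ ω, G ω ^ 2 ∂W
  refine ⟨(2 / lam + 2 * g) / A + 1 + 1, fun x hx => ?_⟩
  have hsq : 0 ≤ ∫ ω, represented κ x ω ^ 2 ∂W := integral_nonneg fun ω => sq_nonneg _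
  have hx' : ‖x.2‖ ^ 2 + lam * ∫ ω, represented κ x ω ^ 2 ∂W ≤ 1 := hx
  have h1 : ‖x.2‖ ≤ 1 := by
    have := mul_nonneg hlam.le hsq
    nlinarith [norm_nonneg x.2]
  have h2 : ∫ ω, represented κ x ω ^ 2 ∂W ≤ 1 / lam := by
    rw [le_div_iff₀ hlam]; nlinarith [sq_nonneg ‖x.2‖]
  have h3 : x.1 ^ 2 * A ≤ 2 * (∫ ω, represented κ x ω ^ 2 ∂W) + 2 * g := by
    have hi := hA.integrable_mul x x
    simp only [← pow_two] at hi
    have : ∫ _ : Ω, x.1 ^ 2 ∂W ≤ ∫ ω, (2 * represented κ x ω ^ 2 + 2 * G ω ^ 2) ∂W := by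
      refine integral_mono (integrable_const _) ((hi.const_mul _).add
        (hA.integrable_majorant_sq.const_mul _)) fun ω => ?_
      have e1 : x.1 = represented κ x ω - ⟪κ ω, x.2⟫_ℝ := by simp [represented]
      have e2 : |⟪κ ω, x.2⟫_ℝ| ≤ G ω :=
        (abs_real_inner_le_norm _ _).trans (by
          nlinarith [hA.norm_le ω, norm_nonneg (κ ω), norm_nonneg x.2])
      have e3 := sq_le_sq' (neg_le_of_abs_le e2) (le_of_abs_le e2)
      simp only
      rw [e1]
      nlinarith [sq_nonneg (represented κ x ω + ⟪κ ω, x.2⟫_ℝ)]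
    rw [integral_const, integral_add (hi.const_mul _) (hA.integrable_majorant_sq.const_mul _),
      integral_const_mul, integral_const_mul, smul_eq_mul] at this
    linarith
  have h4 : x.1 ^ 2 ≤ (2 / lam + 2 * g) / A := by
    rw [le_div_iff₀ hA0]
    have : 2 / lam = 2 * (1 / lam) := by ring
    linarith
  have h5 : |x.1| ≤ x.1 ^ 2 + 1 := by
    rw [← sq_abs]; nlinarith [sq_nonneg (|x.1| - 1), abs_nonneg x.1]
  linarith



theorem exists_maximizer [CompleteSpace H] [TopologicalSpace.SeparableSpace H]
    [IsFiniteMeasure W] (hW : W ≠ 0) (hA : IsAdmissible W κ G q) (hlam : 0 < lam) :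
    ∃ x : ℝ × H, energy W κ lam x = 1 ∧ 0 < posMass W κ q x ∧
      ∀ y, 0 < energy W κ lam y →
        posMass W κ q y ≤ posMass W κ q x * energy W κ lam y ^ (q / 2) := by
  have hq := hA.two_lt
  obtain ⟨R, hR⟩ := hA.exists_bound hW hlam
  have hbdd : BddAbove (posMass W κ q '' {x | energy W κ lam x ≤ 1}) := by
    refine ⟨∫ ω, R ^ q * G ω ^ q ∂W, ?_⟩
    rintro _ ⟨x, hx, rfl⟩
    refine integral_mono_of_nonneg (ae_of_all _ fun ω => by positivity)
      (hA.integrable.const_mul _) (ae_of_all _ fun ω => ?_)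
    exact hA.posPart_rpow_le (by linarith) (hR x hx) ω
  have hzero : energy W κ lam ((0 : ℝ), (0 : H)) ≤ 1 := by
    simp [energy, represented_const]
  have hne : (posMass W κ q '' {x | energy W κ lam x ≤ 1}).Nonempty := ⟨_, _, hzero, rfl⟩
  obtain ⟨u, -, hu, hmem⟩ := exists_seq_tendsto_sSup hne hbdd
  choose x hx hxu using hmem
  set M := sSup (posMass W κ q '' {x | energy W κ lam x ≤ 1}) with hM
  have hle : ∀ y, energy W κ lam y ≤ 1 → posMass W κ q y ≤ M := fun y hy =>
    le_csSup hbdd ⟨y, hy, rfl⟩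
  have hb : ∀ n, |(x n).1| + ‖(x n).2‖ ≤ R := fun n => hR _ (hx n)
  obtain ⟨h, φ, hφ, hw⟩ := exists_weakly_convergent_subseq (x := fun n => (x n).2) (R := R)
    (fun n => by linarith [hb n, abs_nonneg (x n).1])
  obtain ⟨a, -, ψ, hψ, ha⟩ := (isCompact_Icc (a := -R) (b := R)).isSeqCompact
    (x := fun n => (x (φ n)).1) (fun n => by
      rw [mem_Icc, ← abs_le]; linarith [hb (φ n), norm_nonneg (x (φ n)).2])
  set θ : ℕ → ℕ := φ ∘ ψ
  have hθ : StrictMono θ := hφ.comp hψ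
  have hw' : ∀ z, Tendsto (fun n => ⟪(x (θ n)).2, z⟫_ℝ) atTop (𝓝 ⟪h, z⟫_ℝ) := fun z =>
    (hw z).comp hψ.tendsto_atTop
  have hpt : ∀ ω, Tendsto (fun n => represented κ (x (θ n)) ω) atTop
      (𝓝 (represented κ (a, h) ω)) := fun ω => by
    refine ha.add ?_
    have := hw' (κ ω)
    simpa only [real_inner_comm] using this
  have hQ : posMass W κ q (a, h) = M := by
    refine tendsto_nhds_unique (hA.tendsto_posMass (fun n => hb (θ n)) hpt) ?_
    have := hu.comp hθ.tendsto_atTop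
    refine this.congr fun n => ?_
    simp [hxu]
  have hJ : energy W κ lam (a, h) ≤ 1 := by
    have h1 := hA.tendsto_integral_sq (fun n => hb (θ n)) hpt
    have h2 : ∀ n, ⟪(x (θ n)).2, h⟫_ℝ ≤
        √(1 - lam * ∫ ω, represented κ (x (θ n)) ω ^ 2 ∂W) * ‖h‖ := fun n => by
      refine (real_inner_le_norm _ _).trans (mul_le_mul_of_nonneg_right ?_ (norm_nonneg _))
      refine Real.le_sqrt_of_sq_le ?_
      have : ‖(x (θ n)).2‖ ^ 2 + lam * ∫ ω, represented κ (x (θ n)) ω ^ 2 ∂W ≤ 1 := hx (θ n)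
      linarith
    have h3 := le_of_tendsto_of_tendsto' (hw' h)
      (((tendsto_const_nhds.sub (h1.const_mul lam)).sqrt).mul_const ‖h‖) h2
    have h0 : 0 ≤ 1 - lam * ∫ ω, represented κ (a, h) ω ^ 2 ∂W := by
      refine ge_of_tendsto' (tendsto_const_nhds.sub (h1.const_mul lam)) fun n => ?_
      have : ‖(x (θ n)).2‖ ^ 2 + lam * ∫ ω, represented κ (x (θ n)) ω ^ 2 ∂W ≤ 1 := hx (θ n)
      nlinarith [sq_nonneg ‖(x (θ n)).2‖]
    rw [real_inner_self_eq_norm_sq] at h3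
    have h4 := Real.sq_sqrt h0
    have h5 := Real.sqrt_nonneg (1 - lam * ∫ ω, represented κ (a, h) ω ^ 2 ∂W)
    have h6 : ‖h‖ ≤ √(1 - lam * ∫ ω, represented κ (a, h) ω ^ 2 ∂W) := by
      by_contra! hc
      nlinarith [norm_nonneg h]
    rw [energy]
    nlinarith [norm_nonneg h]
  have hscale : ∀ y, 0 < energy W κ lam y →
      posMass W κ q y ≤ M * energy W κ lam y ^ (q / 2) := fun y hy => by
    have h1 := hle ((√(energy W κ lam y))⁻¹ • y) (by
      rw [energy_smul, inv_pow, Real.sq_sqrt hy.le, inv_mul_cancel₀ hy.ne'])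
    rw [posMass_smul _ (by positivity), Real.inv_rpow (Real.sqrt_nonneg _),
      Real.sqrt_eq_rpow, ← Real.rpow_mul hy.le, inv_mul_le_iff₀ (by positivity)] at h1
    rwa [mul_comm, one_div_mul_eq_div] at h1
  have hA0 : 0 < W.real univ := by
    simp [measureReal_def, ENNReal.toReal_pos_iff, hW, pos_iff_ne_zero]
  have hM0 : 0 < M := by
    have h1 := hscale ((1 : ℝ), (0 : H)) (by
      simp only [energy, represented_const]; simp; positivity)
    simp only [energy, posMass, represented_const] at h1
    simp only [zero_le_one, sup_of_le_left, Real.one_rpow, integral_const, smul_eq_mul, mul_one,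
      norm_zero, one_pow] at h1
    by_contra! hc
    have : 0 ≤ (0 ^ 2 + lam * W.real univ) ^ (q / 2) := by positivity
    nlinarith [mul_nonneg (neg_nonneg.2 hc) this]
  have hpos : 0 < energy W κ lam (a, h) := by
    have hnn : 0 ≤ ∫ ω, represented κ (a, h) ω ^ 2 ∂W := integral_nonneg fun ω => sq_nonneg _
    refine lt_of_le_of_ne (by rw [energy]; positivity) fun h0 => ?_
    have h1 : ∫ ω, represented κ (a, h) ω ^ 2 ∂W = 0 := by
      rw [energy] at h0
      by_contra hne
      have : 0 < ∫ ω, represented κ (a, h) ω ^ 2 ∂W := lt_of_le_of_ne hnn (Ne.symm hne)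
      have : 0 < ‖(a, h).2‖ ^ 2 + lam * ∫ ω, represented κ (a, h) ω ^ 2 ∂W := by positivity
      linarith
    have hi := hA.integrable_mul (a, h) (a, h)
    simp only [← pow_two] at hi
    rw [integral_eq_zero_iff_of_nonneg (fun ω => sq_nonneg _) hi] at h1
    have h2 : posMass W κ q (a, h) = 0 := by
      refine integral_eq_zero_of_ae ?_
      filter_upwards [h1] with ω hω
      have : represented κ (a, h) ω = 0 := by simpa using hω
      simp [this, Real.zero_rpow (by linarith : q ≠ 0)]
    linarith
  refine ⟨(a, h), le_antisymm hJ ?_, by rwa [hQ], by rwa [hQ]⟩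
  have h1 := hscale (a, h) hpos
  rw [hQ] at h1
  by_contra! hlt
  have h2 := Real.rpow_lt_one hpos.le hlt (by linarith : 0 < q / 2)
  nlinarith

theorem hasDerivAt_posMass (hA : IsAdmissible W κ G q) (x y : ℝ × H) :
    HasDerivAt (fun t : ℝ => posMass W κ q (x + t • y))
      (∫ ω, q * (max (represented κ x ω) 0) ^ (q - 1) * represented κ y ω ∂W) 0 := by
  have hq := hA.two_lt
  set R := |x.1| + ‖x.2‖ + (|y.1| + ‖y.2‖)
  have hR : ∀ t : ℝ, |t| ≤ 1 → |(x + t • y).1| + ‖(x + t • y).2‖ ≤ R := fun t ht => by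
    have h1 : |(x + t • y).1| ≤ |x.1| + |t| * |y.1| := by
      rw [← abs_mul]; exact abs_add_le _ _
    have h2 : ‖(x + t • y).2‖ ≤ ‖x.2‖ + |t| * ‖y.2‖ := by
      rw [← Real.norm_eq_abs, ← norm_smul]; exact norm_add_le _ _
    nlinarith [abs_nonneg y.1, norm_nonneg y.2]
  have hR0 : 0 ≤ R := by positivity
  have hmeas : ∀ (z : ℝ × H) (r : ℝ), Measurable fun ω => (max (represented κ z ω) 0) ^ r :=
    fun z r => ((hA.measurable_represented z).max measurable_const).pow_const r
  have key := hasDerivAt_integral_of_dominated_loc_of_deriv_le (μ := W) (x₀ := (0 : ℝ))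
    (s := Metric.ball 0 1)
    (F := fun t ω => (max (represented κ (x + t • y) ω) 0) ^ q)
    (F' := fun t ω => q * (max (represented κ (x + t • y) ω) 0) ^ (q - 1) * represented κ y ω)
    (bound := fun ω => q * R ^ (q - 1) * R * G ω ^ q)
    (Metric.ball_mem_nhds _ one_pos) ?_ ?_ ?_ ?_ ?_ ?_
  · have h0 := key.2
    simp only [zero_smul, add_zero] at h0
    exact h0
  · exact Eventually.of_forall fun t => (hmeas _ _).aestronglyMeasurable
  · refine (hA.integrable.const_mul (R ^ q)).mono' (hmeas _ _).aestronglyMeasurable ?_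
    filter_upwards with ω
    rw [Real.norm_of_nonneg (by positivity)]
    exact hA.posPart_rpow_le (by linarith) (hR 0 (by simp)) ω
  · exact (((hmeas _ _).const_mul _).mul (hA.measurable_represented y)).aestronglyMeasurable
  · filter_upwards with ω t ht
    have ht' : |t| ≤ 1 := by simpa using (Metric.mem_ball.1 ht).le
    have h1 := hA.posPart_rpow_le (by linarith : 0 ≤ q - 1) (hR t ht') ω
    have hG : 0 ≤ G ω := zero_le_one.trans (hA.one_le ω)
    have h2 : |represented κ y ω| ≤ R * G ω := (hA.abs_represented_le y ω).trans
      (mul_le_mul_of_nonneg_right (by simp only [R]; linarith [abs_nonneg x.1, norm_nonneg x.2]) hG)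
    have h3 : G ω ^ q = G ω ^ (q - 1) * G ω := by
      rw [← Real.rpow_add_one (by linarith [hA.one_le ω])]; ring_nf
    rw [norm_mul, Real.norm_of_nonneg (by positivity), Real.norm_eq_abs, h3]
    calc q * (max (represented κ (x + t • y) ω) 0) ^ (q - 1) * |represented κ y ω|
        ≤ q * (R ^ (q - 1) * G ω ^ (q - 1)) * (R * G ω) := by gcongr
      _ = _ := by ring
  · exact hA.integrable.const_mul _
  · filter_upwards with ω t _
    have h1 : HasDerivAt (fun t : ℝ => represented κ (x + t • y) ω) (represented κ y ω) t := by
      simp only [represented_add_smul]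
      simpa using ((hasDerivAt_id t).mul_const (represented κ y ω)).const_add (represented κ x ω)
    exact (hasDerivAt_posPart_rpow (by linarith) _).comp t h1

theorem euler_lagrange (hA : IsAdmissible W κ G q) {x : ℝ × H}
    (hx : energy W κ lam x = 1) (hpos : 0 < posMass W κ q x)
    (hmax : ∀ y, 0 < energy W κ lam y →
        posMass W κ q y ≤ posMass W κ q x * energy W κ lam y ^ (q / 2)) (y : ℝ × H) :
    ⟪x.2, y.2⟫_ℝ + lam * ∫ ω, represented κ x ω * represented κ y ω ∂W =
      (posMass W κ q x)⁻¹ *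
        ∫ ω, (max (represented κ x ω) 0) ^ (q - 1) * represented κ y ω ∂W := by
  have hq := hA.two_lt
  set M := posMass W κ q x with hM
  set B := ⟪x.2, y.2⟫_ℝ + lam * ∫ ω, represented κ x ω * represented κ y ω ∂W with hB
  have h1 : HasDerivAt (fun t : ℝ => energy W κ lam (x + t • y)) (2 * B) 0 := by
    simp only [hA.energy_add_smul, ← hB]
    have := (((hasDerivAt_id (0 : ℝ)).mul_const (2 * B)).const_add (energy W κ lam x)).add
      (((hasDerivAt_id (0 : ℝ)).pow 2).mul_const (energy W κ lam y))
    refine this.congr_deriv ?_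
    simp
  have he : energy W κ lam (x + (0 : ℝ) • y) = 1 := by simpa using hx
  have h2 := ((h1.rpow_const (p := q / 2) (Or.inl (by rw [he]; exact one_ne_zero))).const_mul M).sub
    (hA.hasDerivAt_posMass x y)
  have hmin : IsLocalMin ((fun t : ℝ => M * energy W κ lam (x + t • y) ^ (q / 2))
      - fun t : ℝ => posMass W κ q (x + t • y)) 0 := by
    have hc := h1.continuousAt.eventually (lt_mem_nhds (a := 0) (by simp only [he]; exact one_pos))
    filter_upwards [hc] with t ht
    simp only [Pi.sub_apply]
    rw [he]
    have := hmax _ ht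
    simp only [zero_smul, add_zero, Real.one_rpow, mul_one, ← hM]
    linarith
  have h3 := hmin.hasDerivAt_eq_zero h2
  rw [he, Real.one_rpow] at h3
  simp only [mul_assoc, integral_const_mul] at h3
  have hq0 : q ≠ 0 := by linarith
  have h4 : q * (M * B) =
      q * ∫ ω, (max (represented κ x ω) 0) ^ (q - 1) * represented κ y ω ∂W := by
    linarith
  rw [← mul_left_cancel₀ hq0 h4, inv_mul_cancel_left₀ hpos.ne']

end IsAdmissible

end Variational

theorem one_sub_sq_pos {t : ℝ} (ht : t ∈ Ioo (-1 : ℝ) 1) : 0 < 1 - t ^ 2 := by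
  nlinarith [ht.1, ht.2]

theorem one_sub_sq_rpow_le {a t : ℝ} (ht : t ∈ Ioo (-1 : ℝ) 1) :
    (1 - t ^ 2) ^ a ≤ 1 + ((1 - t) ^ a + (1 + t) ^ a) := by
  have h1 : 0 < 1 - t := by linarith [ht.2]
  have h2 : 0 < 1 + t := by linarith [ht.1]
  have h3 := Real.rpow_nonneg h1.le a
  have h4 := Real.rpow_nonneg h2.le a
  rcases le_total 0 a with ha | ha
  · have := Real.rpow_le_one (one_sub_sq_pos ht).le (by nlinarith [sq_nonneg t]) ha
    linarith
  · have e : (1 - t ^ 2) ^ a = (1 - t) ^ a * (1 + t) ^ a := by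
      rw [← Real.mul_rpow h1.le h2.le]; ring_nf
    rw [e]
    rcases le_total 0 t with h | h
    · have := Real.rpow_le_one_of_one_le_of_nonpos (by linarith : 1 ≤ 1 + t) ha
      nlinarith
    · have := Real.rpow_le_one_of_one_le_of_nonpos (by linarith : 1 ≤ 1 - t) ha
      nlinarith

theorem integrableOn_one_sub_sq_rpow {a : ℝ} (ha : -1 < a) :
    IntegrableOn (fun t : ℝ => (1 - t ^ 2) ^ a) (Ioo (-1) 1) := by
  have h1 : IntegrableOn (fun t : ℝ => (1 - t) ^ a) (Ioo (-1) 1) := by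
    have := (intervalIntegral.intervalIntegrable_rpow' (a := 2) (b := 0) ha).comp_sub_left 1
    norm_num at this
    exact (intervalIntegrable_iff_integrableOn_Ioo_of_le (by norm_num)).1 this
  have h2 : IntegrableOn (fun t : ℝ => (1 + t) ^ a) (Ioo (-1) 1) := by
    have := (intervalIntegral.intervalIntegrable_rpow' (a := 0) (b := 2) ha).comp_add_left 1
    norm_num at this
    exact (intervalIntegrable_iff_integrableOn_Ioo_of_le (by norm_num)).1 this
  have h0 : IntegrableOn (fun _ : ℝ => (1 : ℝ)) (Ioo (-1) 1) := by simp
  refine Integrable.mono' (h0.add (h1.add h2))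
    ((show Measurable fun t : ℝ => 1 - t ^ 2 by fun_prop).pow_const a).aestronglyMeasurable ?_
  filter_upwards [ae_restrict_mem measurableSet_Ioo] with t ht
  rw [Real.norm_of_nonneg (Real.rpow_nonneg (one_sub_sq_pos ht).le _)]
  exact one_sub_sq_rpow_le ht

theorem hasDerivAt_of_weak_identity {m : ℝ} {g f : ℝ → ℝ}
    (hg : IntervalIntegrable g volume (-1) 1) (hgc : ContinuousOn g (Ioo (-1) 1))
    (hf : ∀ x ∈ Ioo (-1 : ℝ) 1, ∀ y ∈ Ioo (-1 : ℝ) 1, x < y → f y - f x =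
      -∫ s in (-1 : ℝ)..1, g s *
        ∫ t in x..s, (Ioc x y).indicator (fun t => (1 - t ^ 2) ^ (-m)) t)
    {y : ℝ} (hy : y ∈ Ioo (-1 : ℝ) 1) :
    HasDerivAt f (-((1 - y ^ 2) ^ (-m) * ∫ s in y..1, g s)) y := by
  obtain ⟨x, hx1, hxy⟩ := exists_between hy.1
  have hx : x ∈ Ioo (-1 : ℝ) 1 := ⟨hx1, hxy.trans hy.2⟩
  have hrc : ContinuousOn (fun t : ℝ => (1 - t ^ 2) ^ (-m)) (Ioo (-1) 1) :=
    ContinuousOn.rpow_const (by fun_prop) fun t ht => Or.inl (one_sub_sq_pos ht).ne'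
  set R : ℝ → ℝ := fun s => ∫ t in x..s, (1 - t ^ 2) ^ (-m) with hR
  have hsub : ∀ {a b : ℝ}, a ∈ Ioo (-1 : ℝ) 1 → b ∈ Ioo (-1 : ℝ) 1 → uIcc a b ⊆ Ioo (-1) 1 :=
    fun ha hb => (ordConnected_Ioo.uIcc_subset ha hb)
  have hRd : ∀ s ∈ Ioo (-1 : ℝ) 1, HasDerivAt R ((1 - s ^ 2) ^ (-m)) s := fun s hs =>
    intervalIntegral.integral_hasDerivAt_right
      ((hrc.mono (hsub hx hs)).intervalIntegrable)
      (hrc.stronglyMeasurableAtFilter isOpen_Ioo _ hs)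
      (hrc.continuousAt (isOpen_Ioo.mem_nhds hs))
  have hRc : ContinuousOn R (Ioo (-1) 1) := fun s hs => (hRd s hs).continuousAt.continuousWithinAt
  have hgRc : ContinuousOn (fun s => g s * R s) (Ioo (-1) 1) := hgc.mul hRc
  have hgi : ∀ a ∈ Icc (-1 : ℝ) 1, ∀ b ∈ Icc (-1 : ℝ) 1, IntervalIntegrable g volume a b :=
    fun a ha b hb => hg.mono_set (by
      rw [uIcc_of_le (by norm_num : (-1 : ℝ) ≤ 1)]; exact ordConnected_Icc.uIcc_subset ha hb)
  have hIcc : ∀ {a : ℝ}, a ∈ Ioo (-1 : ℝ) 1 → a ∈ Icc (-1 : ℝ) 1 := fun h => Ioo_subset_Icc_self h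
  have hm1 : (-1 : ℝ) ∈ Icc (-1 : ℝ) 1 := by norm_num
  have hp1 : (1 : ℝ) ∈ Icc (-1 : ℝ) 1 := by norm_num
  have hform : ∀ z ∈ Ioo x 1, f z = f x - ((∫ s in x..z, g s * R s) + R z * ∫ s in z..1, g s) := by
    intro z hz
    have hz' : z ∈ Ioo (-1 : ℝ) 1 := ⟨hx1.trans hz.1, hz.2⟩
    set φ : ℝ → ℝ := fun s => ∫ t in x..s, (Ioc x z).indicator (fun t => (1 - t ^ 2) ^ (-m)) t
      with hφ
    have e1 : ∀ s, s ≤ x → φ s = 0 := fun s hs => by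
      rw [hφ]; simp only
      rw [intervalIntegral.integral_symm, intervalIntegral.integral_of_le hs,
        setIntegral_eq_zero_of_forall_eq_zero, neg_zero]
      intro t ht
      exact indicator_of_notMem (fun h => not_lt.2 ht.2 h.1) _
    have e2 : ∀ s, x ≤ s → s ≤ z → φ s = R s := fun s hs hsz => by
      refine intervalIntegral.integral_congr_ae (ae_of_all _ fun t ht => ?_)
      rw [uIoc_of_le hs] at ht
      exact indicator_of_mem (show t ∈ Ioc x z from ⟨ht.1, ht.2.trans hsz⟩) _
    have e3 : ∀ s, z ≤ s → φ s = R z := fun s hs => by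
      rw [hφ, hR]; simp only
      rw [intervalIntegral.integral_of_le (hz.1.le.trans hs),
        intervalIntegral.integral_of_le hz.1.le, setIntegral_indicator measurableSet_Ioc]
      congr 2
      exact inter_eq_right.2 (Ioc_subset_Ioc_right hs)
    have c1 : ∫ s in (-1 : ℝ)..x, g s * φ s = 0 := by
      rw [intervalIntegral.integral_congr (g := fun _ => (0 : ℝ)), intervalIntegral.integral_zero]
      intro s hs
      rw [uIcc_of_le hx1.le] at hs
      simp [e1 s hs.2]
    have c2 : EqOn (fun s => g s * φ s) (fun s => g s * R s) (uIcc x z) := by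
      intro s hs
      rw [uIcc_of_le hz.1.le] at hs
      simp [e2 s hs.1 hs.2]
    have c3 : EqOn (fun s => g s * φ s) (fun s => R z * g s) (uIcc z 1) := by
      intro s hs
      rw [uIcc_of_le hz.2.le] at hs
      simp [e3 s hs.1, mul_comm]
    have i1 : IntervalIntegrable (fun s => g s * φ s) volume (-1) x := by
      refine (IntervalIntegrable.zero (μ := volume)).congr (fun s hs => ?_)
      rw [uIoc_of_le hx1.le] at hs
      simp [e1 s hs.2]
    have i2 : IntervalIntegrable (fun s => g s * φ s) volume x z :=
      ((hgRc.mono (hsub hx hz')).intervalIntegrable).congr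
        (fun s hs => (c2 (uIoc_subset_uIcc hs)).symm)
    have i3 : IntervalIntegrable (fun s => g s * φ s) volume z 1 :=
      ((hgi z (hIcc hz') 1 hp1).const_mul (R z)).congr
        (fun s hs => (c3 (uIoc_subset_uIcc hs)).symm)
    have := hf x hx z hz' hz.1
    rw [← intervalIntegral.integral_add_adjacent_intervals (i1.trans i2) i3,
      ← intervalIntegral.integral_add_adjacent_intervals i1 i2, c1,
      intervalIntegral.integral_congr c2, intervalIntegral.integral_congr c3,
      intervalIntegral.integral_const_mul] at this
    linarith
  have d1 : HasDerivAt (fun z => ∫ s in x..z, g s * R s) (g y * R y) y :=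
    intervalIntegral.integral_hasDerivAt_right ((hgRc.mono (hsub hx hy)).intervalIntegrable)
      (hgRc.stronglyMeasurableAtFilter isOpen_Ioo _ hy)
      (hgRc.continuousAt (isOpen_Ioo.mem_nhds hy))
  have d2 : HasDerivAt (fun z => ∫ s in z..1, g s) (-g y) y :=
    intervalIntegral.integral_hasDerivAt_left (hgi y (hIcc hy) 1 hp1)
      (hgc.stronglyMeasurableAtFilter isOpen_Ioo _ hy)
      (hgc.continuousAt (isOpen_Ioo.mem_nhds hy))
  have d3 := (d1.add ((hRd y hy).mul d2)).const_sub (f x)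
  refine (d3.congr_of_eventuallyEq ?_).congr_deriv (by ring)
  filter_upwards [isOpen_Ioo.mem_nhds (⟨hxy, hy.2⟩ : y ∈ Ioo x 1)] with z hz
  exact hform z hz

/-- Lebesgue measure on `(-1, 1)`. -/
noncomputable abbrev volIoo : Measure ℝ := volume.restrict (Ioo (-1 : ℝ) 1)

/-- The measure `(1 - t²)^(m-1) dt` on `(-1, 1)`. -/
noncomputable def ultraMeasure (m : ℝ) : Measure ℝ :=
  volIoo.withDensity fun t => (((1 - t ^ 2) ^ (m - 1)).toNNReal : ENNReal)

theorem measurable_weight (m : ℝ) : Measurable fun t : ℝ => ((1 - t ^ 2) ^ (m - 1)).toNNReal :=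
  ((show Measurable fun t : ℝ => 1 - t ^ 2 by fun_prop).pow_const _).real_toNNReal

theorem integral_ultraMeasure (m : ℝ) (F : ℝ → ℝ) :
    ∫ t, F t ∂(ultraMeasure m) = ∫ t in (-1 : ℝ)..1, (1 - t ^ 2) ^ (m - 1) * F t := by
  rw [ultraMeasure, integral_withDensity_eq_integral_smul (measurable_weight m),
    intervalIntegral.integral_of_le (by norm_num), integral_Ioc_eq_integral_Ioo]
  refine setIntegral_congr_fun measurableSet_Ioo fun t ht => ?_
  simp only [NNReal.smul_def, smul_eq_mul]
  rw [Real.coe_toNNReal _ (Real.rpow_nonneg (one_sub_sq_pos ht).le _)]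

theorem integrable_ultraMeasure_iff (m : ℝ) (F : ℝ → ℝ) :
    Integrable F (ultraMeasure m) ↔
      IntegrableOn (fun t => (1 - t ^ 2) ^ (m - 1) * F t) (Ioo (-1) 1) := by
  rw [ultraMeasure, integrable_withDensity_iff_integrable_smul (measurable_weight m)]
  refine integrableOn_congr_fun (fun t ht => ?_) measurableSet_Ioo
  simp only [NNReal.smul_def, smul_eq_mul]
  rw [Real.coe_toNNReal _ (Real.rpow_nonneg (one_sub_sq_pos ht).le _)]

theorem isFiniteMeasure_ultraMeasure {m : ℝ} (hm : 0 < m) : IsFiniteMeasure (ultraMeasure m) := by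
  have h := (integrable_ultraMeasure_iff m fun _ => (1 : ℝ)).2 (by
    simpa using integrableOn_one_sub_sq_rpow (by linarith : -1 < m - 1))
  exact (integrable_const_iff_isFiniteMeasure one_ne_zero).1 h

theorem continuousOn_one_sub_sq_rpow (a : ℝ) :
    ContinuousOn (fun t : ℝ => (1 - t ^ 2) ^ a) (Ioo (-1) 1) :=
  ContinuousOn.rpow_const (by fun_prop) fun t ht => Or.inl (one_sub_sq_pos ht).ne'

/-- The kernel whose pairing with `h` is `∫ t in 0..s, (1 - t²)^(-m/2) * h t`. -/
noncomputable def evalKernel (m s t : ℝ) : ℝ :=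
  (Ioc 0 s).indicator (fun t => (1 - t ^ 2) ^ (-m / 2)) t
    - (Ioc s 0).indicator (fun t => (1 - t ^ 2) ^ (-m / 2)) t

theorem measurable_evalKernel (m s : ℝ) : Measurable (evalKernel m s) := by
  have : Measurable fun t : ℝ => (1 - t ^ 2) ^ (-m / 2) :=
    (show Measurable fun t : ℝ => 1 - t ^ 2 by fun_prop).pow_const _
  exact (this.indicator measurableSet_Ioc).sub (this.indicator measurableSet_Ioc)

theorem evalKernel_sq_le {m α s t : ℝ} (hα : 0 ≤ α) (hs : s ∈ Ioo (-1 : ℝ) 1)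
    (ht : t ∈ Ioo (-1 : ℝ) 1) :
    evalKernel m s t ^ 2 ≤ (1 - s ^ 2) ^ (-(2 * α)) * (1 - t ^ 2) ^ (-(m - 2 * α)) := by
  have hs0 := one_sub_sq_pos hs
  have ht0 := one_sub_sq_pos ht
  have main : t ^ 2 ≤ s ^ 2 → ((1 - t ^ 2) ^ (-m / 2)) ^ 2 ≤
      (1 - s ^ 2) ^ (-(2 * α)) * (1 - t ^ 2) ^ (-(m - 2 * α)) := fun hts => by
    have e : ((1 - t ^ 2) ^ (-m / 2)) ^ 2
        = (1 - t ^ 2) ^ (-(2 * α)) * (1 - t ^ 2) ^ (-(m - 2 * α)) := by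
      rw [← Real.rpow_natCast, ← Real.rpow_mul ht0.le, ← Real.rpow_add ht0]
      congr 1; push_cast; ring
    rw [e]
    refine mul_le_mul_of_nonneg_right ?_ (Real.rpow_nonneg ht0.le _)
    exact Real.rpow_le_rpow_of_nonpos hs0 (by linarith) (by linarith)
  have hnn : 0 ≤ (1 - s ^ 2) ^ (-(2 * α)) * (1 - t ^ 2) ^ (-(m - 2 * α)) := by positivity
  unfold evalKernel
  by_cases h1 : t ∈ Ioc 0 s
  · have h2 : t ∉ Ioc s 0 := fun h => by linarith [h1.1, h.2]
    rw [indicator_of_mem h1, indicator_of_notMem h2, sub_zero]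
    exact main (pow_le_pow_left₀ h1.1.le h1.2 2)
  · by_cases h2 : t ∈ Ioc s 0
    · rw [indicator_of_notMem h1, indicator_of_mem h2, zero_sub, neg_sq]
      exact main (by nlinarith [h2.1, h2.2])
    · rw [indicator_of_notMem h1, indicator_of_notMem h2]
      simpa using hnn

theorem integrable_evalKernel_bound {m α : ℝ} (hα : m - 1 < 2 * α) (c : ℝ) :
    Integrable (fun t : ℝ => c * (1 - t ^ 2) ^ (-(m - 2 * α))) volIoo :=
  (integrableOn_one_sub_sq_rpow (by linarith)).const_mul c

theorem memLp_evalKernel {m s : ℝ} (hs : s ∈ Ioo (-1 : ℝ) 1) :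
    MemLp (evalKernel m s) 2 volIoo := by
  rw [memLp_two_iff_integrable_sq (measurable_evalKernel m s).aestronglyMeasurable]
  refine (integrable_evalKernel_bound (m := m) (α := |m|) (by cases abs_cases m <;> linarith)
    ((1 - s ^ 2) ^ (-(2 * |m|)))).mono'
    ((measurable_evalKernel m s).pow_const 2).aestronglyMeasurable ?_
  filter_upwards [ae_restrict_mem measurableSet_Ioo] with t ht
  rw [Real.norm_of_nonneg (sq_nonneg _)]
  exact evalKernel_sq_le (abs_nonneg m) hs ht

open Classical in
/-- The evaluation vector at `s`. -/
noncomputable def evalVec (m s : ℝ) : Lp ℝ 2 volIoo :=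
  if hs : s ∈ Ioo (-1 : ℝ) 1 then (memLp_evalKernel (m := m) hs).toLp _ else 0

theorem integral_evalKernel_mul (m s : ℝ) (hs : s ∈ Ioo (-1 : ℝ) 1) (k : ℝ → ℝ) :
    ∫ t, evalKernel m s t * k t ∂volIoo = ∫ t in 0..s, (1 - t ^ 2) ^ (-m / 2) * k t := by
  rcases le_total 0 s with h | h
  · have e : (fun t => evalKernel m s t * k t) =
        (Ioc 0 s).indicator fun t => (1 - t ^ 2) ^ (-m / 2) * k t := by
      ext t
      by_cases h1 : t ∈ Ioc 0 s <;> simp [evalKernel, h1, Ioc_eq_empty (not_lt.2 h)]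
    rw [e, integral_indicator measurableSet_Ioc, Measure.restrict_restrict measurableSet_Ioc,
      intervalIntegral.integral_of_le h, inter_eq_left.2]
    exact fun t ht => ⟨by linarith [ht.1], ht.2.trans_lt hs.2⟩
  · have e : (fun t => evalKernel m s t * k t) =
        (Ioc s 0).indicator fun t => -((1 - t ^ 2) ^ (-m / 2) * k t) := by
      ext t
      by_cases h1 : t ∈ Ioc s 0 <;> simp [evalKernel, h1, Ioc_eq_empty (not_lt.2 h)]
    rw [e, integral_indicator measurableSet_Ioc, Measure.restrict_restrict measurableSet_Ioc,
      intervalIntegral.integral_of_ge h, inter_eq_left.2, integral_neg]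
    exact fun t ht => ⟨hs.1.trans ht.1, by linarith [ht.2]⟩

theorem inner_evalVec {m s : ℝ} (hs : s ∈ Ioo (-1 : ℝ) 1) (h : Lp ℝ 2 volIoo) {k : ℝ → ℝ}
    (hk : h =ᵐ[volIoo] k) :
    ⟪evalVec m s, h⟫_ℝ = ∫ t in 0..s, (1 - t ^ 2) ^ (-m / 2) * k t := by
  rw [← integral_evalKernel_mul m s hs, evalVec, dif_pos hs, L2.inner_def]
  refine integral_congr_ae ?_
  filter_upwards [hk, (memLp_evalKernel (m := m) hs).coeFn_toLp] with t h1 h2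
  rw [h1, h2]; simp [mul_comm]

theorem norm_evalVec_le {m α s : ℝ} (hα : 0 ≤ α) (hmα : m - 1 < 2 * α)
    (hs : s ∈ Ioo (-1 : ℝ) 1) :
    ‖evalVec m s‖ ≤ (1 + ∫ t in Ioo (-1 : ℝ) 1, (1 - t ^ 2) ^ (-(m - 2 * α))) *
      (1 - s ^ 2) ^ (-α) := by
  set I := ∫ t in Ioo (-1 : ℝ) 1, (1 - t ^ 2) ^ (-(m - 2 * α)) with hI
  have hI0 : 0 ≤ I := setIntegral_nonneg measurableSet_Ioo fun t ht =>
    Real.rpow_nonneg (one_sub_sq_pos ht).le _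
  have hs0 := one_sub_sq_pos hs
  have h1 : ‖evalVec m s‖ ^ 2 ≤ (1 - s ^ 2) ^ (-(2 * α)) * I := by
    rw [← real_inner_self_eq_norm_sq, evalVec, dif_pos hs, L2.inner_def, hI, ← integral_const_mul]
    refine integral_mono_of_nonneg (ae_of_all _ fun t => real_inner_self_nonneg)
      (integrable_evalKernel_bound hmα _) ?_
    filter_upwards [ae_restrict_mem measurableSet_Ioo,
      (memLp_evalKernel (m := m) hs).coeFn_toLp] with t ht h2
    rw [h2]
    have := evalKernel_sq_le (m := m) hα hs ht
    simpa [pow_two] using this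
  have h2 : (1 - s ^ 2) ^ (-(2 * α)) = ((1 - s ^ 2) ^ (-α)) ^ 2 := by
    rw [pow_two ((1 - s ^ 2) ^ (-α)), ← Real.rpow_add hs0]; congr 1; ring
  refine abs_le_of_sq_le_sq' ?_ (by positivity) |>.2
  rw [mul_pow]
  rw [h2] at h1
  have h3 : 0 ≤ ((1 - s ^ 2) ^ (-α)) ^ 2 := sq_nonneg _
  nlinarith

theorem intervalIntegrable_mul_Lp (m : ℝ) (h : Lp ℝ 2 volIoo) {a b : ℝ} (ha : a ∈ Ioo (-1 : ℝ) 1)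
    (hb : b ∈ Ioo (-1 : ℝ) 1) :
    IntervalIntegrable (fun t => (1 - t ^ 2) ^ (-m / 2) * h t) volume a b := by
  have h1 : IntegrableOn h (Ioo (-1) 1) := (Lp.memLp h).integrable (by norm_num)
  have hsub : uIcc a b ⊆ Ioo (-1) 1 := ordConnected_Ioo.uIcc_subset ha hb
  have h2 : IntervalIntegrable h volume a b :=
    intervalIntegrable_iff.2 (h1.mono_set (uIoc_subset_uIcc.trans hsub))
  exact h2.continuousOn_mul ((continuousOn_one_sub_sq_rpow _).mono hsub)

theorem continuousOn_inner_evalVec (m : ℝ) (h : Lp ℝ 2 volIoo) :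
    ContinuousOn (fun s => ⟪evalVec m s, h⟫_ℝ) (Ioo (-1) 1) := by
  have h0 : (0 : ℝ) ∈ Ioo (-1 : ℝ) 1 := by norm_num
  have : ContinuousOn (fun s => ∫ t in 0..s, (1 - t ^ 2) ^ (-m / 2) * h t) (Ioo (-1) 1) := by
    intro s hs
    obtain ⟨b, hb1, hb2⟩ := exists_between (max_lt (abs_lt.2 hs) one_pos)
    have hsb := abs_lt.1 ((le_max_left _ _).trans_lt hb1)
    have hb0 : 0 < b := (le_max_right _ _).trans_lt hb1
    have hb : b ∈ Ioo (-1 : ℝ) 1 := ⟨by linarith, hb2⟩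
    have hb' : -b ∈ Ioo (-1 : ℝ) 1 := ⟨by linarith, by linarith⟩
    have hc := intervalIntegral.continuousOn_primitive_interval'
      (intervalIntegrable_mul_Lp m h hb' hb) (a := 0)
      (by rw [uIcc_of_le (by linarith)]; exact ⟨by linarith, hb0.le⟩)
    rw [uIcc_of_le (by linarith)] at hc
    exact (hc.continuousAt (Icc_mem_nhds hsb.1 hsb.2)).continuousWithinAt
  exact this.congr fun s hs => inner_evalVec hs h (ae_eq_refl _)

theorem measurable_inner_evalVec (m : ℝ) (h : Lp ℝ 2 volIoo) :
    Measurable fun s => ⟪evalVec m s, h⟫_ℝ := by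
  classical
  have h1 : (fun s => ⟪evalVec m s, h⟫_ℝ) =
      (Ioo (-1 : ℝ) 1).piecewise (fun s => ⟪evalVec m s, h⟫_ℝ) (fun _ => (0 : ℝ)) := by
    ext s
    by_cases hs : s ∈ Ioo (-1 : ℝ) 1
    · rw [piecewise_eq_of_mem _ _ _ hs]
    · rw [piecewise_eq_of_notMem _ _ _ hs, evalVec, dif_neg hs, inner_zero_left]
  rw [h1]
  exact (continuousOn_inner_evalVec m h).measurable_piecewise continuousOn_const measurableSet_Ioo

open Classical in
theorem exists_isAdmissible {m α q : ℝ} (hα : 0 ≤ α) (hmα : m - 1 < 2 * α) (hq2 : 2 < q)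
    (hq : q * α < m) :
    ∃ C, IsAdmissible (ultraMeasure m) (evalVec m)
      ((Ioo (-1 : ℝ) 1).piecewise (fun s => C * (1 - s ^ 2) ^ (-α)) fun _ => 1) q := by
  set I := ∫ t in Ioo (-1 : ℝ) 1, (1 - t ^ 2) ^ (-(m - 2 * α)) with hI
  have hI0 : 0 ≤ I := setIntegral_nonneg measurableSet_Ioo fun t ht =>
    Real.rpow_nonneg (one_sub_sq_pos ht).le _
  refine ⟨1 + I, ?_, ?_, ?_, ?_, measurable_inner_evalVec m, hq2⟩
  · intro s
    by_cases hs : s ∈ Ioo (-1 : ℝ) 1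
    · rw [piecewise_eq_of_mem _ _ _ hs]
      exact norm_evalVec_le hα hmα hs
    · rw [piecewise_eq_of_notMem _ _ _ hs, evalVec, dif_neg hs, norm_zero]
      exact zero_le_one
  · intro s
    by_cases hs : s ∈ Ioo (-1 : ℝ) 1
    · rw [piecewise_eq_of_mem _ _ _ hs]
      have := Real.one_le_rpow_of_pos_of_le_one_of_nonpos (one_sub_sq_pos hs)
        (by nlinarith [sq_nonneg s]) (neg_nonpos.2 hα)
      nlinarith
    · rw [piecewise_eq_of_notMem _ _ _ hs]
  · exact ((continuousOn_one_sub_sq_rpow _).const_mul (1 + I) : ContinuousOn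
      (fun s : ℝ => (1 + I) * (1 - s ^ 2) ^ (-α)) _).measurable_piecewise continuousOn_const
      measurableSet_Ioo
  · rw [integrable_ultraMeasure_iff]
    refine IntegrableOn.congr_fun ((integrableOn_one_sub_sq_rpow
      (by linarith : -1 < m - 1 - q * α)).const_mul ((1 + I) ^ q)) (fun s hs => ?_)
      measurableSet_Ioo
    have hs0 := one_sub_sq_pos hs
    simp only [piecewise_eq_of_mem _ _ _ hs]
    rw [Real.mul_rpow (by positivity) (by positivity), ← Real.rpow_mul hs0.le,
      show m - 1 - q * α = m - 1 + -α * q by ring, Real.rpow_add hs0]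
    ring

theorem eventually_one_add_mul_rpow_lt {r β κ : ℝ} (h : r * β < κ) :
    ∀ᶠ z in 𝓝[>] (0 : ℝ), (1 + β * z) ^ r < 1 + κ * z := by
  have h1 : HasDerivAt (fun z : ℝ => 1 + β * z) β 0 := by
    simpa using ((hasDerivAt_id (0 : ℝ)).const_mul β).const_add 1
  have h2 : HasDerivAt (fun z : ℝ => 1 + κ * z) κ 0 := by
    simpa using ((hasDerivAt_id (0 : ℝ)).const_mul κ).const_add 1
  have h3 := h2.sub (h1.rpow_const (p := r) (Or.inl (by norm_num)))
  have h4 := h3.tendsto_slope_zero_right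
  have h5 := h4.eventually (lt_mem_nhds (a := 0) (by simp; linarith))
  filter_upwards [h5, self_mem_nhdsWithin] with z hz hz0
  have hz0' : 0 < z := hz0
  simp only [Pi.sub_apply, zero_add, mul_zero, add_zero, Real.one_rpow, sub_self, sub_zero,
    smul_eq_mul] at hz
  have := pos_of_mul_pos_right hz (inv_pos.2 hz0').le
  linarith

theorem eventually_taylor_le_one_add_rpow {q κ : ℝ} (hκ : 2 * κ < q * (q - 1)) :
    ∀ᶠ x in 𝓝 (0 : ℝ), 1 + q * x + κ * x ^ 2 ≤ (1 + x) ^ q := by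
  set ψ : ℝ → ℝ := fun x => (1 + x) ^ q - (1 + q * x + κ * x ^ 2) with hψ
  have hd : ∀ x : ℝ, -1 < x → HasDerivAt ψ (q * (1 + x) ^ (q - 1) - (q + 2 * κ * x)) x := by
    intro x hx
    have h1 : HasDerivAt (fun z : ℝ => 1 + z) 1 x := (hasDerivAt_id x).const_add 1
    have h2 := (h1.rpow_const (p := q) (Or.inl (by linarith))).sub
      ((((hasDerivAt_id x).const_mul q).const_add 1).add (((hasDerivAt_id x).pow 2).const_mul κ))
    refine h2.congr_deriv ?_
    simp; ring
  have hev : deriv ψ =ᶠ[𝓝 0] fun x => q * (1 + x) ^ (q - 1) - (q + 2 * κ * x) := by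
    filter_upwards [Ioi_mem_nhds (by norm_num : (-1 : ℝ) < 0)] with x hx
    exact (hd x hx).deriv
  have h2 : HasDerivAt (fun x : ℝ => q * (1 + x) ^ (q - 1) - (q + 2 * κ * x))
      (q * (q - 1) - 2 * κ) 0 := by
    have h1 : HasDerivAt (fun z : ℝ => 1 + z) 1 0 := (hasDerivAt_id 0).const_add 1
    have h3 := ((h1.rpow_const (p := q - 1) (Or.inl (by norm_num))).const_mul q).sub
      (((hasDerivAt_id (0 : ℝ)).const_mul (2 * κ)).const_add q)
    refine h3.congr_deriv ?_
    simp
  have hmin : IsLocalMin ψ 0 := by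
    refine isLocalMin_of_deriv_deriv_pos ?_ ?_ (hd 0 (by norm_num)).continuousAt
    · rw [hev.deriv_eq, h2.deriv]; linarith
    · rw [(hd 0 (by norm_num)).deriv]; simp
  filter_upwards [hmin] with x hx
  simp only [hψ] at hx
  norm_num at hx
  linarith

theorem hasDerivAt_one_sub_sq_rpow {a t : ℝ} (ht : t ∈ Ioo (-1 : ℝ) 1) :
    HasDerivAt (fun t : ℝ => (1 - t ^ 2) ^ a) (-(2 * a * t * (1 - t ^ 2) ^ (a - 1))) t := by
  have h1 : HasDerivAt (fun t : ℝ => 1 - t ^ 2) (-(2 * t)) t := by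
    simpa using ((hasDerivAt_id t).pow 2).const_sub 1
  exact (h1.rpow_const (Or.inl (one_sub_sq_pos ht).ne')).congr_deriv (by ring)

theorem intervalIntegrable_weight {m : ℝ} (hm : 0 < m) :
    IntervalIntegrable (fun t : ℝ => (1 - t ^ 2) ^ (m - 1)) volume (-1) 1 :=
  (intervalIntegrable_iff_integrableOn_Ioo_of_le (by norm_num)).2
    (integrableOn_one_sub_sq_rpow (by linarith))

theorem intervalIntegrable_weight_mul {m : ℝ} (hm : 0 < m) {F : ℝ → ℝ} (hF : Continuous F) :
    IntervalIntegrable (fun t : ℝ => (1 - t ^ 2) ^ (m - 1) * F t) volume (-1) 1 :=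
  (intervalIntegrable_weight hm).mul_continuousOn hF.continuousOn

theorem integral_weight_mul_id {m : ℝ} (hm : 0 < m) :
    ∫ t in (-1 : ℝ)..1, (1 - t ^ 2) ^ (m - 1) * t = 0 := by
  have h := intervalIntegral.integral_eq_sub_of_hasDerivAt_of_le (a := -1) (b := 1) (by norm_num)
    (f := fun t : ℝ => -(2 * m)⁻¹ * (1 - t ^ 2) ^ m)
    (f' := fun t : ℝ => (1 - t ^ 2) ^ (m - 1) * t)
    ((ContinuousOn.rpow_const (by fun_prop) fun _ _ => Or.inr hm.le).const_mul _ |>.congr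
      fun _ _ => rfl)
    (fun t ht => ((hasDerivAt_one_sub_sq_rpow ht).const_mul _).congr_deriv (by field_simp))
    (intervalIntegrable_weight_mul hm continuous_id)
  rw [h]; norm_num

theorem integral_one_sub_sq_rpow_eq {m : ℝ} (hm : 0 < m) :
    ∫ t in (-1 : ℝ)..1, (1 - t ^ 2) ^ m =
      2 * m * ∫ t in (-1 : ℝ)..1, (1 - t ^ 2) ^ (m - 1) * t ^ 2 := by
  have i1 : IntervalIntegrable (fun t : ℝ => (1 - t ^ 2) ^ m) volume (-1) 1 :=
    (ContinuousOn.rpow_const (by fun_prop) fun _ _ => Or.inr hm.le).intervalIntegrable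
  have i2 :=
    (intervalIntegrable_weight_mul hm (F := fun t => t ^ 2) (by fun_prop)).const_mul (2 * m)
  have h := intervalIntegral.integral_eq_sub_of_hasDerivAt_of_le (a := -1) (b := 1) (by norm_num)
    (f := fun t : ℝ => t * (1 - t ^ 2) ^ m)
    (f' := fun t : ℝ => (1 - t ^ 2) ^ m - 2 * m * ((1 - t ^ 2) ^ (m - 1) * t ^ 2))
    (continuousOn_id.mul (ContinuousOn.rpow_const (by fun_prop) fun _ _ => Or.inr hm.le))
    (fun t ht => ((hasDerivAt_id t).mul (hasDerivAt_one_sub_sq_rpow ht)).congr_deriv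
      (by simp only [id]; ring))
    (i1.sub i2)
  rw [intervalIntegral.integral_sub i1 i2, intervalIntegral.integral_const_mul] at h
  norm_num [Real.zero_rpow hm.ne'] at h
  linarith

theorem memLp_tangent {m : ℝ} (hm : 0 < m) :
    MemLp (fun t : ℝ => (1 - t ^ 2) ^ (m / 2)) 2 volIoo := by
  have hmeas : Measurable fun t : ℝ => (1 - t ^ 2) ^ (m / 2) :=
    (show Measurable fun t : ℝ => 1 - t ^ 2 by fun_prop).pow_const _
  rw [memLp_two_iff_integrable_sq hmeas.aestronglyMeasurable]
  refine IntegrableOn.congr_fun (integrableOn_one_sub_sq_rpow (by linarith : -1 < m))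
    (fun t ht => ?_) measurableSet_Ioo
  rw [pow_two ((1 - t ^ 2) ^ (m / 2)), ← Real.rpow_add (one_sub_sq_pos ht)]; congr 1; ring

theorem represented_tangent {m : ℝ} (hm : 0 < m) (ε : ℝ) {s : ℝ} (hs : s ∈ Ioo (-1 : ℝ) 1) :
    represented (evalVec m) (1, ε • (memLp_tangent hm).toLp _) s = 1 + ε * s := by
  rw [represented, inner_smul_right, inner_evalVec hs _ (memLp_tangent hm).coeFn_toLp]
  rw [intervalIntegral.integral_congr (g := fun _ => (1 : ℝ))]
  · simp
  · intro t ht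
    have h0 : (0 : ℝ) ∈ Ioo (-1 : ℝ) 1 := by norm_num
    have ht' := (ordConnected_Ioo.uIcc_subset h0 hs) ht
    simp only
    rw [← Real.rpow_add (one_sub_sq_pos ht'), show -m / 2 + m / 2 = 0 by ring, Real.rpow_zero]

theorem norm_tangent_sq {m : ℝ} (hm : 0 < m) :
    ‖(memLp_tangent hm).toLp _‖ ^ 2 = ∫ t in (-1 : ℝ)..1, (1 - t ^ 2) ^ m := by
  rw [← real_inner_self_eq_norm_sq, L2.inner_def, intervalIntegral.integral_of_le (by norm_num),
    integral_Ioc_eq_integral_Ioo]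
  refine integral_congr_ae ?_
  filter_upwards [(memLp_tangent hm).coeFn_toLp, ae_restrict_mem measurableSet_Ioo] with t h1 ht
  rw [h1]
  simp only [RCLike.inner_apply, conj_trivial]
  rw [← Real.rpow_add (one_sub_sq_pos ht)]; congr 1; ring

theorem integral_ultraMeasure_congr {m : ℝ} {F F' : ℝ → ℝ} (h : ∀ s ∈ Ioo (-1 : ℝ) 1, F s = F' s) :
    ∫ s, F s ∂(ultraMeasure m) = ∫ s, F' s ∂(ultraMeasure m) := by
  rw [integral_ultraMeasure, integral_ultraMeasure,
    intervalIntegral.integral_of_le (by norm_num), intervalIntegral.integral_of_le (by norm_num),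
    integral_Ioc_eq_integral_Ioo, integral_Ioc_eq_integral_Ioo]
  exact setIntegral_congr_fun measurableSet_Ioo fun s hs => by simp only [h s hs]

theorem maximizer_not_const {m q lam : ℝ} (hm : 0 < m) (hq : 2 < q) (hlam : 0 < lam)
    (hl : 2 * m < lam * (q - 2)) {x : ℝ × Lp ℝ 2 volIoo}
    (hx : energy (ultraMeasure m) (evalVec m) lam x = 1)
    (hpos : 0 < posMass (ultraMeasure m) (evalVec m) q x)
    (hmax : ∀ y, 0 < energy (ultraMeasure m) (evalVec m) lam y →
      posMass (ultraMeasure m) (evalVec m) q y ≤ posMass (ultraMeasure m) (evalVec m) q x *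
        energy (ultraMeasure m) (evalVec m) lam y ^ (q / 2)) :
    ¬ ∃ c, ∀ s ∈ Ioo (-1 : ℝ) 1, represented (evalVec m) x s = c := by
  rintro ⟨c, hc⟩
  set A := ∫ t in (-1 : ℝ)..1, (1 - t ^ 2) ^ (m - 1) with hA
  set B := ∫ t in (-1 : ℝ)..1, (1 - t ^ 2) ^ (m - 1) * t ^ 2 with hB
  have hA0 : 0 < A := intervalIntegral.intervalIntegral_pos_of_pos_on
    (intervalIntegrable_weight hm) (fun t ht => Real.rpow_pos_of_pos (one_sub_sq_pos ht) _)
    (by norm_num)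
  have hB0 : 0 < B := by
    have := integral_one_sub_sq_rpow_eq hm
    have h2 : 0 < ∫ t in (-1 : ℝ)..1, (1 - t ^ 2) ^ m :=
      intervalIntegral.intervalIntegral_pos_of_pos_on
        (ContinuousOn.rpow_const (by fun_prop) fun _ _ => Or.inr hm.le).intervalIntegrable
        (fun t ht => Real.rpow_pos_of_pos (one_sub_sq_pos ht) _) (by norm_num)
    rw [this] at h2
    exact pos_of_mul_pos_right h2 (by positivity)
  have hconst : ∀ d : ℝ, ∫ _, d ∂(ultraMeasure m) = A * d := fun d => by
    rw [integral_ultraMeasure, intervalIntegral.integral_mul_const]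
  have hM : posMass (ultraMeasure m) (evalVec m) q x = A * (max c 0) ^ q := by
    rw [posMass, integral_ultraMeasure_congr (F' := fun _ => (max c 0) ^ q)
      (fun s hs => by rw [hc s hs]), hconst]
  have hc0 : 0 < c := by
    by_contra! h
    rw [hM, max_eq_right h, Real.zero_rpow (by linarith), mul_zero] at hpos
    exact lt_irrefl _ hpos
  rw [max_eq_left hc0.le] at hM
  have he : ‖x.2‖ ^ 2 + lam * (A * c ^ 2) = 1 := by
    rw [← hx, energy, integral_ultraMeasure_congr (F' := fun _ => c ^ 2)
      (fun s hs => by rw [hc s hs]), hconst]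
  have he1 : lam * (A * c ^ 2) = 1 := by
    refine le_antisymm (by nlinarith [sq_nonneg ‖x.2‖]) ?_
    have e1 : energy (ultraMeasure m) (evalVec m) lam (c, 0) = lam * (A * c ^ 2) := by
      simp only [energy, represented_const, hconst]; simp
    have e2 : posMass (ultraMeasure m) (evalVec m) q (c, 0) = A * c ^ q := by
      simp only [posMass, represented_const, hconst, max_eq_left hc0.le]
    have h1 := hmax (c, 0) (by rw [e1]; positivity)
    rw [e1, e2, hM] at h1
    by_contra! hlt
    have := Real.rpow_lt_one (by positivity) hlt (by linarith : 0 < q / 2)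
    have : 0 < A * c ^ q := by positivity
    nlinarith
  set β := 1 + 2 * m / lam with hβ
  have hβq : β < q - 1 := by
    rw [hβ]
    have : 2 * m / lam < q - 2 := by rw [div_lt_iff₀ hlam]; linarith
    linarith
  obtain ⟨κ, hκ1, hκ2⟩ := exists_between (show q / 2 * β < q * (q - 1) / 2 by nlinarith)
  obtain ⟨δ, hδ, hT⟩ := Metric.eventually_nhds_iff.1
    (eventually_taylor_le_one_add_rpow (by linarith : 2 * κ < q * (q - 1)))
  have hz : Tendsto (fun ε : ℝ => B / A * ε ^ 2) (𝓝[>] 0) (𝓝[>] 0) := by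
    refine tendsto_nhdsWithin_iff.2 ⟨?_, ?_⟩
    · have : Tendsto (fun ε : ℝ => B / A * ε ^ 2) (𝓝 0) (𝓝 (B / A * 0 ^ 2)) :=
        Continuous.tendsto (by fun_prop) 0
      simp only [ne_eq, OfNat.ofNat_ne_zero, not_false_eq_true, zero_pow, mul_zero] at this
      exact this.mono_left nhdsWithin_le_nhds
    · filter_upwards [self_mem_nhdsWithin] with ε hε
      have : (0 : ℝ) < ε := hε
      exact mem_Ioi.2 (by positivity)
  have hsmall : ∀ᶠ ε in 𝓝[>] (0 : ℝ), ε < min δ 1 :=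
    nhdsWithin_le_nhds (Iio_mem_nhds (lt_min hδ one_pos))
  have hpos' : ∀ᶠ ε in 𝓝[>] (0 : ℝ), ε ∈ Ioi (0 : ℝ) := self_mem_nhdsWithin
  obtain ⟨ε, hε1, hε2, hε3⟩ :=
    ((hz.eventually (eventually_one_add_mul_rpow_lt hκ1)).and (hsmall.and hpos')).exists
  have hε0 : 0 < ε := hε3
  have hεδ : ε < δ := lt_of_lt_of_le hε2 (min_le_left _ _)
  have hε1' : ε < 1 := lt_of_lt_of_le hε2 (min_le_right _ _)
  set y : ℝ × Lp ℝ 2 volIoo := (1, ε • (memLp_tangent hm).toLp _) with hy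
  have hrep : ∀ s ∈ Ioo (-1 : ℝ) 1, represented (evalVec m) y s = 1 + ε * s := fun s hs =>
    represented_tangent hm ε hs
  have iw := fun (F : ℝ → ℝ) (hF : Continuous F) => intervalIntegrable_weight_mul hm hF
  have hquad : ∀ b d : ℝ, ∫ t in (-1 : ℝ)..1, (1 - t ^ 2) ^ (m - 1) * (1 + b * t + d * t ^ 2) =
      A + d * B := fun b d => by
    have i1 := intervalIntegrable_weight hm
    have i2 := (iw id continuous_id).const_mul b
    have i3 := (iw (fun t => t ^ 2) (by fun_prop)).const_mul d
    have : ∀ t : ℝ, (1 - t ^ 2) ^ (m - 1) * (1 + b * t + d * t ^ 2) = ((1 - t ^ 2) ^ (m - 1) +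
      b * ((1 - t ^ 2) ^ (m - 1) * id t)) + d * ((1 - t ^ 2) ^ (m - 1) * t ^ 2) := fun t => by
      simp only [id]; ring
    simp only [this]
    rw [intervalIntegral.integral_add (i1.add i2) i3, intervalIntegral.integral_add i1 i2,
      intervalIntegral.integral_const_mul, intervalIntegral.integral_const_mul]
    simp only [id, integral_weight_mul_id hm]
    ring
  have hJ : energy (ultraMeasure m) (evalVec m) lam y = lam * A * (1 + β * (B / A * ε ^ 2)) := by
    have h1 : ‖y.2‖ ^ 2 = ε ^ 2 * (2 * m * B) := by
      rw [hy, norm_smul, mul_pow, norm_tangent_sq hm, integral_one_sub_sq_rpow_eq hm,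
        Real.norm_eq_abs,
        sq_abs]
    rw [energy, h1, integral_ultraMeasure_congr (F' := fun s => 1 + 2 * ε * s + ε ^ 2 * s ^ 2)
      (fun s hs => by rw [hrep s hs]; ring), integral_ultraMeasure, hquad, hβ]
    field_simp; ring
  have hQ : A + κ * ε ^ 2 * B ≤ posMass (ultraMeasure m) (evalVec m) q y := by
    rw [posMass, integral_ultraMeasure_congr (F' := fun s => (1 + ε * s) ^ q) (fun s hs => by
      rw [hrep s hs, max_eq_left (by nlinarith [hs.1, hs.2])]), integral_ultraMeasure,
      ← hquad (q * ε) (κ * ε ^ 2)]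
    refine intervalIntegral.integral_mono_on (by norm_num) (iw _ (by fun_prop))
      (iw _ (Continuous.rpow_const (by fun_prop) fun _ => Or.inr (by linarith))) fun t ht => ?_
    refine mul_le_mul_of_nonneg_left ?_ (Real.rpow_nonneg (by nlinarith [ht.1, ht.2]) _)
    have := hT (y := ε * t) (by
      rw [Real.dist_0_eq_abs, abs_mul, abs_of_pos hε0]
      exact lt_of_le_of_lt (by nlinarith [abs_le.2 ht, abs_nonneg t]) hεδ)
    refine le_trans (le_of_eq ?_) this
    ring
  have hβ0 : 0 < β := by positivity
  have h1 := hmax y (by rw [hJ]; positivity)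
  have h2 : posMass (ultraMeasure m) (evalVec m) q x *
      energy (ultraMeasure m) (evalVec m) lam y ^ (q / 2) =
      A * (1 + β * (B / A * ε ^ 2)) ^ (q / 2) := by
    have : c ^ q = (c ^ 2) ^ (q / 2) := by
      rw [← Real.rpow_natCast, ← Real.rpow_mul hc0.le]; congr 1; push_cast; ring
    rw [hM, hJ, this, mul_assoc, ← Real.mul_rpow (by positivity) (by positivity)]
    congr 2
    calc c ^ 2 * (lam * A * (1 + β * (B / A * ε ^ 2)))
        = lam * (A * c ^ 2) * (1 + β * (B / A * ε ^ 2)) := by ring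
      _ = _ := by rw [he1, one_mul]
  rw [h2] at h1
  have h3 := hQ.trans h1
  have h4 := mul_lt_mul_of_pos_left hε1 hA0
  have h5 : A * (1 + κ * (B / A * ε ^ 2)) = A + κ * ε ^ 2 * B := by field_simp
  linarith

theorem IsAdmissible.integrable_posPart_rpow_mul {Ω H : Type*} [NormedAddCommGroup H]
    [InnerProductSpace ℝ H] [MeasurableSpace Ω] {W : Measure Ω} {κ : Ω → H} {G : Ω → ℝ} {q : ℝ}
    (hA : IsAdmissible W κ G q) (x y : ℝ × H) :
    Integrable (fun ω => (max (represented κ x ω) 0) ^ (q - 1) * represented κ y ω) W := by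
  have hq := hA.two_lt
  refine (hA.integrable.const_mul ((|x.1| + ‖x.2‖) ^ (q - 1) * (|y.1| + ‖y.2‖))).mono'
    ((((hA.measurable_represented x).max measurable_const).pow_const (q - 1)).mul
      (hA.measurable_represented y)).aestronglyMeasurable (ae_of_all _ fun ω => ?_)
  have hG : 0 < G ω := zero_lt_one.trans_le (hA.one_le ω)
  have h0 : 0 ≤ (max (represented κ x ω) 0) ^ (q - 1) := Real.rpow_nonneg (le_max_right _ _) _
  rw [norm_mul, Real.norm_of_nonneg h0, Real.norm_eq_abs]
  have e : G ω ^ q = G ω ^ (q - 1) * G ω := by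
    rw [← Real.rpow_add_one hG.ne']; congr 1; ring
  calc _ ≤ ((|x.1| + ‖x.2‖) ^ (q - 1) * G ω ^ (q - 1)) * ((|y.1| + ‖y.2‖) * G ω) :=
        mul_le_mul (hA.posPart_rpow_le (by linarith) le_rfl ω) (hA.abs_represented_le y ω)
          (abs_nonneg _) (by positivity)
    _ = _ := by rw [e]; ring

/-- The right-hand side of the profile equation in divergence form. -/
noncomputable def source (m lam μ p : ℝ) (f : ℝ → ℝ) (s : ℝ) : ℝ :=
  (1 - s ^ 2) ^ (m - 1) * (lam * f s - μ * (max (f s) 0) ^ p)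

theorem evalKernel_sub {m x y : ℝ} (hxy : x ≤ y) (t : ℝ) :
    evalKernel m y t - evalKernel m x t =
      (Ioc x y).indicator (fun t => (1 - t ^ 2) ^ (-m / 2)) t := by
  simp only [evalKernel, indicator_apply, mem_Ioc]
  split_ifs <;> first | (exfalso; grind) | ring

theorem represented_evalVec_sub {m x y s : ℝ} (hx : x ∈ Ioo (-1 : ℝ) 1) (hy : y ∈ Ioo (-1 : ℝ) 1)
    (hs : s ∈ Ioo (-1 : ℝ) 1) (hxy : x ≤ y) :
    represented (evalVec m)
      (-∫ t in 0..x, (Ioc x y).indicator (fun t => (1 - t ^ 2) ^ (-m)) t,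
        evalVec m y - evalVec m x) s =
      ∫ t in x..s, (Ioc x y).indicator (fun t => (1 - t ^ 2) ^ (-m)) t := by
  have h0 : (0 : ℝ) ∈ Ioo (-1 : ℝ) 1 := by norm_num
  have hI : ∀ a ∈ Ioo (-1 : ℝ) 1, ∀ b ∈ Ioo (-1 : ℝ) 1, IntervalIntegrable
      ((Ioc x y).indicator fun t : ℝ => (1 - t ^ 2) ^ (-m)) volume a b := fun a ha b hb => by
    rw [intervalIntegrable_iff]
    refine Integrable.indicator ?_ measurableSet_Ioc
    exact intervalIntegrable_iff.1 (((continuousOn_one_sub_sq_rpow (-m)).mono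
      (ordConnected_Ioo.uIcc_subset ha hb)).intervalIntegrable)
  have hk : (evalVec m y - evalVec m x : Lp ℝ 2 volIoo) =ᵐ[volIoo]
      (Ioc x y).indicator fun t => (1 - t ^ 2) ^ (-m / 2) := by
    rw [evalVec, evalVec, dif_pos hx, dif_pos hy]
    filter_upwards [Lp.coeFn_sub ((memLp_evalKernel (m := m) hy).toLp _)
      ((memLp_evalKernel (m := m) hx).toLp _), (memLp_evalKernel (m := m) hy).coeFn_toLp,
      (memLp_evalKernel (m := m) hx).coeFn_toLp] with t h1 h2 h3
    rw [h1, Pi.sub_apply, h2, h3, evalKernel_sub hxy]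
  rw [represented, inner_evalVec hs _ hk]
  have e : ∫ t in 0..s, (1 - t ^ 2) ^ (-m / 2) *
      (Ioc x y).indicator (fun t => (1 - t ^ 2) ^ (-m / 2)) t =
      ∫ t in 0..s, (Ioc x y).indicator (fun t => (1 - t ^ 2) ^ (-m)) t := by
    refine intervalIntegral.integral_congr fun t ht => ?_
    have ht' := one_sub_sq_pos ((ordConnected_Ioo.uIcc_subset h0 hs) ht)
    by_cases h : t ∈ Ioc x y
    · simp only [indicator_of_mem h]
      rw [← Real.rpow_add ht']; congr 1; ring
    · simp only [indicator_of_notMem h, mul_zero]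
  rw [e, ← intervalIntegral.integral_add_adjacent_intervals (hI 0 h0 x hx) (hI x hx s hs)]
  ring

theorem intervalIntegral_congr_Ioo {a b : ℝ} (hab : a ≤ b) {F F' : ℝ → ℝ}
    (h : ∀ s ∈ Ioo a b, F s = F' s) : ∫ s in a..b, F s = ∫ s in a..b, F' s := by
  rw [intervalIntegral.integral_of_le hab, intervalIntegral.integral_of_le hab,
    integral_Ioc_eq_integral_Ioo, integral_Ioc_eq_integral_Ioo]
  exact setIntegral_congr_fun measurableSet_Ioo h

theorem exists_weak_solution {m α p lam : ℝ} (hm : 0 < m) (hα : 0 ≤ α) (hmα : m - 1 < 2 * α)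
    (hp : 1 < p) (hpα : (p + 1) * α < m) (hl : 2 * m < lam * (p - 1)) :
    ∃ (f : ℝ → ℝ) (μ C : ℝ), 0 < μ ∧ ContinuousOn f (Ioo (-1) 1) ∧
      (∀ s ∈ Ioo (-1 : ℝ) 1, |f s| ≤ C * (1 - s ^ 2) ^ (-α)) ∧
      IntervalIntegrable (source m lam μ p f) volume (-1) 1 ∧
      ∫ s in (-1 : ℝ)..1, source m lam μ p f s = 0 ∧
      (∀ y ∈ Ioo (-1 : ℝ) 1,
        HasDerivAt f (-((1 - y ^ 2) ^ (-m) * ∫ s in y..1, source m lam μ p f s)) y) ∧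
      ¬ ∃ c, ∀ s ∈ Ioo (-1 : ℝ) 1, f s = c := by
  have hlam : 0 < lam := by
    by_contra! h
    nlinarith
  obtain ⟨C, hA⟩ := exists_isAdmissible hα hmα (by linarith : 2 < p + 1) hpα
  have := isFiniteMeasure_ultraMeasure hm
  have : Fact ((2 : ENNReal) ≠ ⊤) := ⟨by norm_num⟩
  have hW : ultraMeasure m ≠ 0 := fun h => by
    have h1 := integral_ultraMeasure m fun _ => 1
    rw [h, integral_zero_measure] at h1
    have h2 : 0 < ∫ t in (-1 : ℝ)..1, (1 - t ^ 2) ^ (m - 1) * 1 :=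
      intervalIntegral.intervalIntegral_pos_of_pos_on
        (by simpa using intervalIntegrable_weight hm)
        (fun t ht => mul_pos (Real.rpow_pos_of_pos (one_sub_sq_pos ht) _) one_pos) (by norm_num)
    linarith
  obtain ⟨x, hx, hpos, hmax⟩ := hA.exists_maximizer hW hlam
  set f := represented (evalVec m) x with hf
  set μ := (posMass (ultraMeasure m) (evalVec m) (p + 1) x)⁻¹ with hμ
  have hintg : ∀ y : ℝ × Lp ℝ 2 volIoo, Integrable (fun s => (lam * f s - μ * (max (f s) 0) ^ p) *
      represented (evalVec m) y s) (ultraMeasure m) := fun y => by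
    have h2 := hA.integrable_posPart_rpow_mul x y
    rw [add_sub_cancel_right] at h2
    refine (((hA.integrable_mul x y).const_mul lam).sub (h2.const_mul μ)).congr
      (ae_of_all _ fun s => ?_)
    simp only [Pi.sub_apply, ← hf]
    ring
  have hEL : ∀ y : ℝ × Lp ℝ 2 volIoo, ⟪x.2, y.2⟫_ℝ =
      -∫ s in (-1 : ℝ)..1, source m lam μ p f s * represented (evalVec m) y s := fun y => by
    have h1 := hA.euler_lagrange hx hpos hmax y
    have h2 := hA.integrable_posPart_rpow_mul x y
    rw [add_sub_cancel_right] at h1 h2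
    have h3 : ∫ s in (-1 : ℝ)..1, source m lam μ p f s * represented (evalVec m) y s =
        ∫ s, (lam * f s - μ * (max (f s) 0) ^ p) * represented (evalVec m) y s
          ∂(ultraMeasure m) := by
      rw [integral_ultraMeasure]
      simp only [source, mul_assoc]
    have h4 : ∫ s, (lam * f s - μ * (max (f s) 0) ^ p) * represented (evalVec m) y s
          ∂(ultraMeasure m) = lam * ∫ s, f s * represented (evalVec m) y s ∂(ultraMeasure m) -
          μ * ∫ s, (max (f s) 0) ^ p * represented (evalVec m) y s ∂(ultraMeasure m) := by
      rw [← integral_const_mul, ← integral_const_mul,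
        ← integral_sub ((hA.integrable_mul x y).const_mul lam) (h2.const_mul μ)]
      congr 1; ext s; ring
    rw [h3, h4]
    linarith
  have hfc : ContinuousOn f (Ioo (-1) 1) := continuousOn_const.add (continuousOn_inner_evalVec m _)
  have hsi : IntervalIntegrable (source m lam μ p f) volume (-1) 1 := by
    have h1 := (integrable_ultraMeasure_iff m _).1 (hintg (1, 0))
    rw [intervalIntegrable_iff_integrableOn_Ioo_of_le (by norm_num)]
    exact h1.congr_fun (fun s _ => by simp only [represented_const, mul_one, source])
      measurableSet_Ioo
  refine ⟨f, μ, (|x.1| + ‖x.2‖) * C, inv_pos.2 hpos, hfc, fun s hs => ?_, hsi, ?_, fun y hy => ?_,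
    maximizer_not_const hm (by linarith : 2 < p + 1) hlam (by linarith) hx hpos hmax⟩
  · have := hA.abs_represented_le x s
    rw [piecewise_eq_of_mem _ _ _ hs] at this
    linarith
  · have := hEL (1, 0)
    simp only [inner_zero_right, represented_const, mul_one] at this
    linarith
  · have hsc : ContinuousOn (source m lam μ p f) (Ioo (-1) 1) :=
      (continuousOn_one_sub_sq_rpow _).mul ((continuousOn_const.mul hfc).sub
        (continuousOn_const.mul ((hfc.sup continuousOn_const).rpow_const fun _ _ =>
          Or.inr (by linarith))))
    refine hasDerivAt_of_weak_identity hsi hsc (fun a ha b hb hab => ?_) hy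
    have h1 := hEL (-∫ t in 0..a, (Ioc a b).indicator (fun t => (1 - t ^ 2) ^ (-m)) t,
        evalVec m b - evalVec m a)
    simp only [inner_sub_right] at h1
    have h2 : f b - f a = ⟪x.2, evalVec m b⟫_ℝ - ⟪x.2, evalVec m a⟫_ℝ := by
      rw [hf, represented, represented, real_inner_comm, real_inner_comm (evalVec m a)]; ring
    rw [h2, h1]
    congr 1
    refine intervalIntegral_congr_Ioo (by norm_num) fun s hs => ?_
    rw [represented_evalVec_sub ha hb hs hab.le]

/-- `f` solves the integrated profile equation on `(-1, 1)`. -/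
structure IsProfile (m lam μ p : ℝ) (f : ℝ → ℝ) : Prop where
  continuousOn : ContinuousOn f (Ioo (-1) 1)
  integrable : IntervalIntegrable (source m lam μ p f) volume (-1) 1
  integral_eq_zero : ∫ s in (-1 : ℝ)..1, source m lam μ p f s = 0
  hasDerivAt : ∀ y ∈ Ioo (-1 : ℝ) 1,
    HasDerivAt f (-((1 - y ^ 2) ^ (-m) * ∫ s in y..1, source m lam μ p f s)) y

theorem source_comp_neg (m lam μ p : ℝ) (f : ℝ → ℝ) (s : ℝ) :
    source m lam μ p (fun t => f (-t)) s = source m lam μ p f (-s) := by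
  simp [source]

namespace IsProfile

variable {m lam μ p : ℝ} {f : ℝ → ℝ}

theorem intervalIntegrable (hf : IsProfile m lam μ p f) {a b : ℝ} (ha : a ∈ Icc (-1 : ℝ) 1)
    (hb : b ∈ Icc (-1 : ℝ) 1) : IntervalIntegrable (source m lam μ p f) volume a b :=
  hf.integrable.mono_set (by
    rw [uIcc_of_le (by norm_num : (-1 : ℝ) ≤ 1)]; exact ordConnected_Icc.uIcc_subset ha hb)

theorem comp_neg (hf : IsProfile m lam μ p f) : IsProfile m lam μ p fun s => f (-s) := by
  have hs : (fun s => source m lam μ p (fun t => f (-t)) s) = fun s => source m lam μ p f (-s) :=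
    funext fun s => source_comp_neg m lam μ p f s
  refine ⟨hf.continuousOn.comp continuousOn_neg
    fun s hs => ⟨by linarith [hs.2], by linarith [hs.1]⟩,
    ?_, ?_, fun y hy => ?_⟩
  · have := (IntervalIntegrable.iff_comp_neg (f := source m lam μ p f) (a := 1) (b := -1)).1
      hf.integrable.symm
    rw [← hs] at this
    simpa using this
  · rw [hs, intervalIntegral.integral_comp_neg, neg_neg]; exact hf.integral_eq_zero
  · have hy' : -y ∈ Ioo (-1 : ℝ) 1 := ⟨by linarith [hy.2], by linarith [hy.1]⟩
    have h1 : HasDerivAt (fun s => f (-s)) _ y :=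
      (hf.hasDerivAt (-y) hy').comp y (hasDerivAt_neg y)
    refine h1.congr_deriv ?_
    have h2 := intervalIntegral.integral_add_adjacent_intervals
      (hf.intervalIntegrable (a := -1) (b := -y) (by norm_num) (Ioo_subset_Icc_self hy'))
      (hf.intervalIntegrable (a := -y) (b := 1) (Ioo_subset_Icc_self hy') (by norm_num))
    rw [hf.integral_eq_zero] at h2
    rw [hs, intervalIntegral.integral_comp_neg, neg_sq, eq_neg_of_add_eq_zero_left h2]
    ring

theorem abs_deriv_le (hf : IsProfile m lam μ p f) (hm : 1 ≤ m) (hlam : 0 ≤ lam) (hμ : 0 ≤ μ)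
    (hp : 1 ≤ p) {C a b : ℝ} (ha : 0 ≤ a) (hpa : p * a < m) (hb : p * a ≤ b)
    (hC : ∀ s ∈ Ico (0 : ℝ) 1, |f s| ≤ C * (1 - s) ^ (-a)) :
    ∃ D, ∀ y ∈ Ico (0 : ℝ) 1, |deriv f y| ≤ D * (1 - y) ^ (-b) := by
  have hC0 : 0 ≤ C := by
    have := (abs_nonneg _).trans (hC 0 (by norm_num))
    simpa using this
  set D := 2 ^ (m - 1) * (lam * C + μ * C ^ p) with hD
  have hD0 : 0 ≤ D := by positivity
  have hsrc : ∀ s ∈ Ico (0 : ℝ) 1, |source m lam μ p f s| ≤ D * (1 - s) ^ (m - 1 - p * a) := by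
    intro s hs
    have hs1 : 0 < 1 - s := by linarith [hs.2]
    have hfs := hC s hs
    have h1 : (1 - s ^ 2) ^ (m - 1) ≤ 2 ^ (m - 1) * (1 - s) ^ (m - 1) := by
      rw [← Real.mul_rpow (by norm_num) hs1.le]
      exact Real.rpow_le_rpow (by nlinarith [hs.1]) (by nlinarith [hs.1]) (by linarith)
    have h2 : (1 - s) ^ (-a) ≤ (1 - s) ^ (-(p * a)) :=
      Real.rpow_le_rpow_of_exponent_ge hs1 (by linarith [hs.1]) (by nlinarith)
    have h3 : (max (f s) 0) ^ p ≤ C ^ p * (1 - s) ^ (-(p * a)) := by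
      have : (C * (1 - s) ^ (-a)) ^ p = C ^ p * (1 - s) ^ (-(p * a)) := by
        rw [Real.mul_rpow hC0 (by positivity), ← Real.rpow_mul hs1.le]; congr 2; ring
      rw [← this]
      exact Real.rpow_le_rpow (le_max_right _ _)
        (max_le ((le_abs_self _).trans hfs) (by positivity)) (by linarith)
    have h4 : |lam * f s - μ * (max (f s) 0) ^ p| ≤
        (lam * C + μ * C ^ p) * (1 - s) ^ (-(p * a)) := by
      have h5 : 0 ≤ (max (f s) 0) ^ p := Real.rpow_nonneg (le_max_right _ _) _
      calc _ ≤ |lam * f s| + |μ * (max (f s) 0) ^ p| := abs_sub _ _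
        _ = lam * |f s| + μ * (max (f s) 0) ^ p := by
          rw [abs_mul, abs_mul, abs_of_nonneg hlam, abs_of_nonneg hμ, abs_of_nonneg h5]
        _ ≤ lam * (C * (1 - s) ^ (-(p * a))) + μ * (C ^ p * (1 - s) ^ (-(p * a))) := by
          gcongr
          exact hfs.trans (by gcongr)
        _ = _ := by ring
    have h6 : 0 ≤ (1 - s ^ 2) ^ (m - 1) := Real.rpow_nonneg (by nlinarith [hs.1]) _
    rw [source, abs_mul, abs_of_nonneg h6]
    calc _ ≤ (2 ^ (m - 1) * (1 - s) ^ (m - 1)) *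
          ((lam * C + μ * C ^ p) * (1 - s) ^ (-(p * a))) := by gcongr
      _ = D * ((1 - s) ^ (m - 1) * (1 - s) ^ (-(p * a))) := by rw [hD]; ring
      _ = _ := by rw [← Real.rpow_add hs1, ← sub_eq_add_neg]
  refine ⟨D / (m - p * a), fun y hy => ?_⟩
  have hy1 : 0 < 1 - y := by linarith [hy.2]
  have hk : 0 < m - p * a := by linarith
  rw [(hf.hasDerivAt y ⟨by linarith [hy.1], hy.2⟩).deriv, abs_neg, abs_mul]
  have hintg : IntervalIntegrable (fun s : ℝ => (1 - s) ^ (m - 1 - p * a)) volume y 1 := by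
    have := (intervalIntegral.intervalIntegrable_rpow' (by linarith : -1 < m - 1 - p * a)
      (a := 0) (b := 1 - y)).comp_sub_left 1
    simpa using this.symm
  have hval : ∫ s in y..1, (1 - s) ^ (m - 1 - p * a) = (1 - y) ^ (m - p * a) / (m - p * a) := by
    rw [intervalIntegral.integral_comp_sub_left (fun s => s ^ (m - 1 - p * a)), sub_self,
      integral_rpow (Or.inl (by linarith))]
    rw [show m - 1 - p * a + 1 = m - p * a by ring, Real.zero_rpow hk.ne', sub_zero]
  have h1 : |∫ s in y..1, source m lam μ p f s| ≤ D * ((1 - y) ^ (m - p * a) / (m - p * a)) := by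
    rw [← hval, ← intervalIntegral.integral_const_mul, ← Real.norm_eq_abs]
    refine intervalIntegral.norm_integral_le_of_norm_le hy.2.le ?_ (hintg.const_mul D)
    have : ∀ᵐ t : ℝ, t ≠ 1 := by simp [ae_iff]
    filter_upwards [this] with t ht1 ht
    exact hsrc t ⟨hy.1.trans ht.1.le, lt_of_le_of_ne ht.2 ht1⟩
  have h2 : |(1 - y ^ 2) ^ (-m)| ≤ (1 - y) ^ (-m) := by
    rw [abs_of_nonneg (Real.rpow_nonneg (by nlinarith [hy.1]) _)]
    exact Real.rpow_le_rpow_of_nonpos hy1 (by nlinarith [hy.1]) (by linarith)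
  calc _ ≤ (1 - y) ^ (-m) * (D * ((1 - y) ^ (m - p * a) / (m - p * a))) := by gcongr
    _ = D / (m - p * a) * ((1 - y) ^ (-m) * (1 - y) ^ (m - p * a)) := by ring
    _ = D / (m - p * a) * (1 - y) ^ (-(p * a)) := by
      rw [← Real.rpow_add hy1]; congr 2; ring
    _ ≤ _ := by
      refine mul_le_mul_of_nonneg_left ?_ (by positivity)
      exact Real.rpow_le_rpow_of_exponent_ge hy1 (by linarith [hy.1]) (by linarith)

end IsProfile

theorem abs_sub_le_of_abs_deriv_le {f : ℝ → ℝ} {D a : ℝ} (ha : a ≠ 0)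
    (hf : ∀ y ∈ Ico (0 : ℝ) 1, DifferentiableAt ℝ f y)
    (hD : ∀ y ∈ Ico (0 : ℝ) 1, |deriv f y| ≤ D * (1 - y) ^ (-(a + 1))) {y : ℝ}
    (hy : y ∈ Ico (0 : ℝ) 1) : |f y - f 0| ≤ D / a * (1 - y) ^ (-a) - D / a := by
  set h : ℝ → ℝ := fun y => D / a * (1 - y) ^ (-a) with hh
  have hd : ∀ y ∈ Ico (0 : ℝ) 1, HasDerivAt h (D * (1 - y) ^ (-(a + 1))) y := fun y hy => by
    have h1 : HasDerivAt (fun y : ℝ => 1 - y) (-1) y := by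
      simpa using (hasDerivAt_id y).const_sub 1
    refine ((h1.rpow_const (p := -a) (Or.inl (by linarith [hy.2]))).const_mul
      (D / a)).congr_deriv ?_
    rw [show -a - 1 = -(a + 1) by ring]
    field_simp
  have h0 : h 0 = D / a := by simp [hh]
  have hz : (0 : ℝ) ∈ Ico (0 : ℝ) 1 := by norm_num
  have m1 : MonotoneOn (fun y => h y + f y) (Ico 0 1) := by
    refine monotoneOn_of_deriv_nonneg (convex_Ico 0 1) (fun z hz =>
      ((hd z hz).continuousAt.add (hf z hz).continuousAt).continuousWithinAt) (fun z hz => ?_)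
      fun z hz => ?_
    all_goals rw [interior_Ico] at hz
    · exact ((hd z ⟨hz.1.le, hz.2⟩).differentiableAt.add
        (hf z ⟨hz.1.le, hz.2⟩)).differentiableWithinAt
    · have hz' : z ∈ Ico (0 : ℝ) 1 := ⟨hz.1.le, hz.2⟩
      rw [((hd z hz').fun_add (hf z hz').hasDerivAt).deriv]
      linarith [neg_abs_le (deriv f z), hD z hz']
  have m2 : MonotoneOn (fun y => h y - f y) (Ico 0 1) := by
    refine monotoneOn_of_deriv_nonneg (convex_Ico 0 1) (fun z hz =>
      ((hd z hz).continuousAt.sub (hf z hz).continuousAt).continuousWithinAt) (fun z hz => ?_)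
      fun z hz => ?_
    all_goals rw [interior_Ico] at hz
    · exact ((hd z ⟨hz.1.le, hz.2⟩).differentiableAt.sub
        (hf z ⟨hz.1.le, hz.2⟩)).differentiableWithinAt
    · have hz' : z ∈ Ico (0 : ℝ) 1 := ⟨hz.1.le, hz.2⟩
      rw [((hd z hz').fun_sub (hf z hz').hasDerivAt).deriv]
      linarith [le_abs_self (deriv f z), hD z hz']
  have e1 := m1 hz hy hy.1
  have e2 := m2 hz hy hy.1
  simp only [h0] at e1 e2
  rw [abs_le]
  constructor <;> linarith

namespace IsProfile

variable {m lam μ p : ℝ} {f : ℝ → ℝ}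

theorem bounded_of_mul_lt_one (hf : IsProfile m lam μ p f) (hm : 1 ≤ m) (hlam : 0 ≤ lam)
    (hμ : 0 ≤ μ) (hp : 1 ≤ p) {C a : ℝ} (ha : 0 ≤ a) (hpa : p * a < 1)
    (hC : ∀ s ∈ Ico (0 : ℝ) 1, |f s| ≤ C * (1 - s) ^ (-a)) :
    ∃ K, ∀ s ∈ Ico (0 : ℝ) 1, |f s| ≤ K := by
  obtain ⟨D, hD⟩ := hf.abs_deriv_le hm hlam hμ hp ha (by linarith) le_rfl hC
  have hD0 : 0 ≤ D := by
    have := (abs_nonneg _).trans (hD 0 (by norm_num))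
    simpa using this
  refine ⟨|f 0| + D / (1 - p * a), fun s hs => ?_⟩
  have h1 := abs_sub_le_of_abs_deriv_le (a := p * a - 1) (by linarith)
    (fun y hy => (hf.hasDerivAt y ⟨by linarith [hy.1], hy.2⟩).differentiableAt)
    (by simpa using hD) hs
  have h2 : D / (p * a - 1) = -(D / (1 - p * a)) := by rw [← neg_sub 1, div_neg]
  have h3 : 0 ≤ D / (1 - p * a) * (1 - s) ^ (-(p * a - 1)) :=
    mul_nonneg (div_nonneg hD0 (by linarith)) (Real.rpow_nonneg (by linarith [hs.2]) _)
  rw [h2] at h1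
  have h4 := abs_sub_abs_le_abs_sub (f s) (f 0)
  linarith

theorem bounded_right (hf : IsProfile m lam μ p f) (hm : 1 ≤ m) (hlam : 0 ≤ lam)
    (hμ : 0 ≤ μ) (hp : 1 ≤ p) {α : ℝ} (hpα : p * α < m) (hα : (p - 1) * α < 1) (N : ℕ) :
    ∀ a C, 0 ≤ a → a ≤ α → a ≤ N * (1 - (p - 1) * α) →
      (∀ s ∈ Ico (0 : ℝ) 1, |f s| ≤ C * (1 - s) ^ (-a)) →
      ∃ K, ∀ s ∈ Ico (0 : ℝ) 1, |f s| ≤ K := by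
  have hp0 : 0 < p := by linarith
  induction N with
  | zero =>
    intro a C ha _ haN hC
    have : a = 0 := le_antisymm (by simpa using haN) ha
    exact hf.bounded_of_mul_lt_one hm hlam hμ hp ha (by rw [this]; norm_num) hC
  | succ N ih =>
    intro a C ha haα haN hC
    have improve : ∀ b, 0 < b → p * a ≤ b + 1 →
        ∃ C', ∀ s ∈ Ico (0 : ℝ) 1, |f s| ≤ C' * (1 - s) ^ (-b) := fun b hb hab => by
      obtain ⟨D, hD⟩ := hf.abs_deriv_le hm hlam hμ hp ha (by nlinarith) hab hC
      have hD0 : 0 ≤ D := by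
        have := (abs_nonneg _).trans (hD 0 (by norm_num))
        simpa using this
      refine ⟨|f 0| + D / b, fun s hs => ?_⟩
      have h1 := abs_sub_le_of_abs_deriv_le hb.ne'
        (fun y hy => (hf.hasDerivAt y ⟨by linarith [hy.1], hy.2⟩).differentiableAt) hD hs
      have h2 : 1 ≤ (1 - s) ^ (-b) := Real.one_le_rpow_of_pos_of_le_one_of_nonpos
        (by linarith [hs.2]) (by linarith [hs.1]) (by linarith)
      have h4 := abs_sub_abs_le_abs_sub (f s) (f 0)
      have h5 : 0 ≤ D / b := by positivity
      nlinarith [abs_nonneg (f 0)]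
    rcases lt_trichotomy (p * a) 1 with h | h | h
    · exact hf.bounded_of_mul_lt_one hm hlam hμ hp ha h hC
    · have ha0 : 0 < a := by
        rcases ha.lt_or_eq with h0 | h0
        · exact h0
        · rw [← h0, mul_zero] at h; norm_num at h
      obtain ⟨C', hC'⟩ := improve (a / 2) (by linarith) (by linarith)
      exact hf.bounded_of_mul_lt_one hm hlam hμ hp (by linarith) (by linarith) hC'
    · obtain ⟨C', hC'⟩ := improve (p * a - 1) (by linarith) (by linarith)
      refine ih (p * a - 1) C' (by linarith) (by nlinarith) ?_ hC'
      push_cast at haN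
      nlinarith

theorem exists_bound_right (hf : IsProfile m lam μ p f) (hm : 1 ≤ m) (hlam : 0 ≤ lam)
    (hμ : 0 ≤ μ) (hp : 1 ≤ p) {α C : ℝ} (hα0 : 0 ≤ α) (hpα : p * α < m) (hα : (p - 1) * α < 1)
    (hC : ∀ s ∈ Ioo (-1 : ℝ) 1, |f s| ≤ C * (1 - s ^ 2) ^ (-α)) :
    ∃ K, ∀ s ∈ Ico (0 : ℝ) 1, |f s| ≤ K ∧ |deriv f s| ≤ K := by
  have hC0 : 0 ≤ C := by
    have := (abs_nonneg _).trans (hC 0 (by norm_num))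
    simpa using this
  have h1 : ∀ s ∈ Ico (0 : ℝ) 1, |f s| ≤ C * (1 - s) ^ (-α) := fun s hs => by
    refine (hC s ⟨by linarith [hs.1], hs.2⟩).trans (mul_le_mul_of_nonneg_left ?_ hC0)
    exact Real.rpow_le_rpow_of_nonpos (by linarith [hs.2]) (by nlinarith [hs.1, hs.2])
      (by linarith)
  obtain ⟨N, hN⟩ := exists_nat_ge (α / (1 - (p - 1) * α))
  rw [div_le_iff₀ (by linarith)] at hN
  obtain ⟨K, hK⟩ := hf.bounded_right hm hlam hμ hp hpα hα N α C hα0 le_rfl hN h1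
  obtain ⟨D, hD⟩ := hf.abs_deriv_le hm hlam hμ hp (C := K) (a := 0) (b := 0) le_rfl
    (by linarith) (by simp) (by simpa using hK)
  exact ⟨max K D, fun s hs => ⟨(hK s hs).trans (le_max_left _ _),
    (le_trans (by simpa using hD s hs) (le_max_right _ _))⟩⟩

theorem exists_bound (hf : IsProfile m lam μ p f) (hm : 1 ≤ m) (hlam : 0 ≤ lam)
    (hμ : 0 ≤ μ) (hp : 1 ≤ p) {α C : ℝ} (hα0 : 0 ≤ α) (hpα : p * α < m) (hα : (p - 1) * α < 1)
    (hC : ∀ s ∈ Ioo (-1 : ℝ) 1, |f s| ≤ C * (1 - s ^ 2) ^ (-α)) :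
    ∃ K, ∀ s ∈ Ioo (-1 : ℝ) 1, |deriv f s| ≤ K := by
  obtain ⟨K, hK⟩ := hf.exists_bound_right hm hlam hμ hp hα0 hpα hα hC
  obtain ⟨K', hK'⟩ := hf.comp_neg.exists_bound_right (C := C) hm hlam hμ hp hα0 hpα hα
    fun s hs => by simpa using hC (-s) ⟨by linarith [hs.2], by linarith [hs.1]⟩
  refine ⟨max K K', fun s hs => ?_⟩
  rcases le_total 0 s with h | h
  · exact ((hK s ⟨h, hs.2⟩).2).trans (le_max_left _ _)
  · have := (hK' (-s) ⟨by linarith, by linarith [hs.1]⟩).2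
    rw [deriv_comp_neg, abs_neg, neg_neg] at this
    exact this.trans (le_max_right _ _)

theorem congr (hf : IsProfile m lam μ p f) {F : ℝ → ℝ} (h : ∀ s ∈ Ioo (-1 : ℝ) 1, f s = F s) :
    IsProfile m lam μ p F := by
  have hs : ∀ s ∈ Ioo (-1 : ℝ) 1, source m lam μ p f s = source m lam μ p F s := fun s hs => by
    simp only [source, h s hs]
  refine ⟨hf.continuousOn.congr fun s hs => (h s hs).symm, ?_, ?_, fun y hy => ?_⟩
  · have := hf.integrable
    rw [intervalIntegrable_iff_integrableOn_Ioo_of_le (by norm_num)] at this ⊢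
    exact this.congr_fun hs measurableSet_Ioo
  · rw [← intervalIntegral_congr_Ioo (by norm_num) hs]
    exact hf.integral_eq_zero
  · rw [← intervalIntegral_congr_Ioo hy.2.le fun s hs' => hs s ⟨hy.1.trans hs'.1, hs'.2⟩]
    exact (hf.hasDerivAt y hy).congr_of_eventuallyEq
      (by filter_upwards [Ioo_mem_nhds hy.1 hy.2] with z hz using (h z hz).symm)

end IsProfile

theorem exists_continuous_profile {m α p lam : ℝ} (hm : 1 ≤ m) (hα : 0 ≤ α)
    (hmα : m - 1 < 2 * α) (hp : 1 < p) (hpα : (p + 1) * α < m) (hl : 2 * m < lam * (p - 1)) :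
    ∃ (f : ℝ → ℝ) (μ : ℝ), 0 < μ ∧ Continuous f ∧ IsProfile m lam μ p f ∧
      ¬ ∃ c, ∀ s ∈ Ioo (-1 : ℝ) 1, f s = c := by
  obtain ⟨f, μ, C, hμ, h1, h2, h3, h4, h5, h6⟩ :=
    exists_weak_solution (by linarith) hα hmα hp hpα hl
  have hf : IsProfile m lam μ p f := ⟨h1, h3, h4, h5⟩
  have hlam : 0 ≤ lam := by
    by_contra! h
    nlinarith
  obtain ⟨K, hK⟩ := hf.exists_bound hm hlam hμ.le hp.le hα (by nlinarith) (by nlinarith) h2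
  have hlip : LipschitzOnWith K.toNNReal f (Ioo (-1) 1) :=
    (convex_Ioo _ _).lipschitzOnWith_of_nnnorm_deriv_le
      (fun x hx => (h5 x hx).differentiableAt) fun x hx => by
        rw [← NNReal.coe_le_coe, coe_nnnorm, Real.norm_eq_abs]
        exact (hK x hx).trans (Real.le_coe_toNNReal K)
  obtain ⟨F, hF, hfF⟩ := hlip.extend_real
  exact ⟨F, μ, hμ, hF.continuous, hf.congr hfF, fun ⟨c, hc⟩ =>
    h6 ⟨c, fun s hs => (hfF hs).trans (hc s hs)⟩⟩

namespace IsProfile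

variable {m lam μ p : ℝ} {f : ℝ → ℝ}

theorem continuousOn_source (hf : IsProfile m lam μ p f) (hp : 0 ≤ p) :
    ContinuousOn (source m lam μ p f) (Ioo (-1) 1) :=
  (continuousOn_one_sub_sq_rpow _).mul ((continuousOn_const.mul hf.continuousOn).sub
    (continuousOn_const.mul ((hf.continuousOn.sup continuousOn_const).rpow_const fun _ _ =>
      Or.inr hp)))

theorem hasDerivAt_deriv (hf : IsProfile m lam μ p f) (hp : 0 ≤ p) {y : ℝ}
    (hy : y ∈ Ioo (-1 : ℝ) 1) :
    HasDerivAt (deriv f)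
      ((2 * m * y * deriv f y + (lam * f y - μ * (max (f y) 0) ^ p)) / (1 - y ^ 2)) y := by
  have hy0 := one_sub_sq_pos hy
  have hsc := hf.continuousOn_source hp
  have h1 : HasDerivAt (fun y => ∫ s in y..1, source m lam μ p f s) (-source m lam μ p f y) y :=
    intervalIntegral.integral_hasDerivAt_left
      (hf.intervalIntegrable (Ioo_subset_Icc_self hy) (by norm_num))
      (hsc.stronglyMeasurableAtFilter isOpen_Ioo _ hy)
      (hsc.continuousAt (isOpen_Ioo.mem_nhds hy))
  have h2 := ((hasDerivAt_one_sub_sq_rpow (a := -m) hy).mul h1).neg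
  have h3 : deriv f =ᶠ[𝓝 y] -((fun y => (1 - y ^ 2) ^ (-m)) *
      fun y => ∫ s in y..1, source m lam μ p f s) := by
    filter_upwards [Ioo_mem_nhds hy.1 hy.2] with z hz using (hf.hasDerivAt z hz).deriv
  refine (h2.congr_of_eventuallyEq h3).congr_deriv ?_
  have e1 : (1 - y ^ 2) ^ (-m) = (1 - y ^ 2) ^ (-m - 1) * (1 - y ^ 2) := by
    rw [← Real.rpow_add_one hy0.ne']; congr 1; ring
  have e2 : (1 - y ^ 2) ^ (-m) * (1 - y ^ 2) ^ (m - 1) * (1 - y ^ 2) = 1 := by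
    rw [← Real.rpow_add hy0, ← Real.rpow_add_one hy0.ne',
      show -m + (m - 1) + 1 = 0 by ring, Real.rpow_zero]
  rw [eq_div_iff hy0.ne', (hf.hasDerivAt y hy).deriv, source]
  generalize ∫ s in y..1, source m lam μ p f s = I
  generalize lam * f y - μ * (max (f y) 0) ^ p = N at *
  rw [e1] at e2 ⊢
  linear_combination N * e2

theorem deriv_eq_of_isMin (hf : IsProfile m lam μ p f) {x : ℝ} (hx : x ∈ Ico (-1 : ℝ) 1)
    (hmin : ∀ s ∈ Icc (-1 : ℝ) 1, f x ≤ f s) {y : ℝ} (hy : y ∈ Ioo (-1 : ℝ) 1) :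
    deriv f y = (1 - y ^ 2) ^ (-m) * ∫ s in x..y, source m lam μ p f s := by
  have h0 : ∫ s in x..1, source m lam μ p f s = 0 := by
    rcases hx.1.eq_or_lt with h | h
    · rw [← h]; exact hf.integral_eq_zero
    · have hx' : x ∈ Ioo (-1 : ℝ) 1 := ⟨h, hx.2⟩
      have hl : IsLocalMin f x := by
        filter_upwards [Ioo_mem_nhds h hx.2] with s hs using hmin s (Ioo_subset_Icc_self hs)
      have h1 := hl.hasDerivAt_eq_zero (hf.hasDerivAt x hx')
      rw [neg_eq_zero] at h1
      exact (mul_eq_zero.1 h1).resolve_left (Real.rpow_pos_of_pos (one_sub_sq_pos hx') _).ne'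
  have h1 := intervalIntegral.integral_add_adjacent_intervals
    (hf.intervalIntegrable (Ico_subset_Icc_self hx) (Ioo_subset_Icc_self hy))
    (hf.intervalIntegrable (Ioo_subset_Icc_self hy) (b := 1) (by norm_num))
  rw [h0] at h1
  rw [(hf.hasDerivAt y hy).deriv, eq_neg_of_add_eq_zero_right h1]
  ring

theorem nonneg_of_isMin (hf : IsProfile m lam μ p f) (hc : Continuous f) (hlam : 0 < lam)
    (hp : 0 < p) {x : ℝ} (hx : x ∈ Ico (-1 : ℝ) 1) (hmin : ∀ s ∈ Icc (-1 : ℝ) 1, f x ≤ f s) :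
    0 ≤ f x := by
  by_contra! h
  obtain ⟨ε, hε, hball⟩ := Metric.eventually_nhds_iff.1 (hc.continuousAt.eventually (gt_mem_nhds h))
  set b := min (x + ε / 2) ((x + 1) / 2) with hb
  have hb1 : b < x + ε := (min_le_left _ _).trans_lt (by linarith)
  have hb2 : b < 1 := (min_le_right _ _).trans_lt (by linarith [hx.2])
  have hxb : x < b := lt_min (by linarith) (by linarith [hx.2])
  have hanti : StrictAntiOn f (Icc x b) := by
    refine strictAntiOn_of_deriv_neg (convex_Icc _ _) hc.continuousOn fun y hy => ?_
    rw [interior_Icc] at hy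
    have hy' : y ∈ Ioo (-1 : ℝ) 1 := ⟨hx.1.trans_lt hy.1, hy.2.trans hb2⟩
    rw [hf.deriv_eq_of_isMin hx hmin hy']
    refine mul_neg_of_pos_of_neg (Real.rpow_pos_of_pos (one_sub_sq_pos hy') _) ?_
    rw [← neg_pos, ← intervalIntegral.integral_neg]
    refine intervalIntegral.intervalIntegral_pos_of_pos_on
      (hf.intervalIntegrable (Ico_subset_Icc_self hx) (Ioo_subset_Icc_self hy')).neg
      (fun s hs => ?_) hy.1
    have hs' : s ∈ Ioo (-1 : ℝ) 1 := ⟨hx.1.trans_lt hs.1, hs.2.trans hy'.2⟩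
    have hfs : f s < 0 := hball (by
      rw [Real.dist_eq, abs_lt]; constructor <;> linarith [hs.1, hs.2, hy.2])
    rw [neg_pos, source, max_eq_right hfs.le, Real.zero_rpow hp.ne']
    refine mul_neg_of_pos_of_neg (Real.rpow_pos_of_pos (one_sub_sq_pos hs') _) ?_
    nlinarith
  have h1 := hanti (left_mem_Icc.2 hxb.le) (right_mem_Icc.2 hxb.le) hxb
  exact absurd (hmin b ⟨by linarith [hx.1], hb2.le⟩) (not_le.2 h1)

theorem nonneg (hf : IsProfile m lam μ p f) (hc : Continuous f) (hlam : 0 < lam)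
    (hp : 0 < p) {s : ℝ} (hs : s ∈ Icc (-1 : ℝ) 1) : 0 ≤ f s := by
  obtain ⟨x, hx, hmin⟩ := isCompact_Icc.exists_isMinOn (nonempty_Icc.2 (by norm_num))
    (hc.continuousOn (s := Icc (-1 : ℝ) 1))
  refine le_trans ?_ (hmin hs)
  rcases hx.2.lt_or_eq with h | h
  · exact hf.nonneg_of_isMin hc hlam hp ⟨hx.1, h⟩ hmin
  · have := hf.comp_neg.nonneg_of_isMin (x := -x) (hc.comp continuous_neg) hlam hp
      ⟨by linarith, by linarith⟩ fun s hs => by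
        rw [neg_neg]; exact hmin (a := -s) ⟨by linarith [hs.2], by linarith [hs.1]⟩
    simpa using this

theorem weight_ratio_le (hm : 1 ≤ m) {x y b : ℝ} (hx : -1 ≤ x) (hxy : x < y) (hyb : y ≤ b)
    (hb0 : 0 ≤ b) (hb : b < 1) :
    (1 - y ^ 2) ^ (-m) * ∫ s in x..y, (1 - s ^ 2) ^ (m - 1) ≤ 2 * (1 - b ^ 2) ^ (-m) := by
  have hy : y ∈ Ioo (-1 : ℝ) 1 := ⟨by linarith, by linarith⟩
  have hy0 := one_sub_sq_pos hy
  have hb' : 0 < 1 - b ^ 2 := by nlinarith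
  have hcont : ∀ c d : ℝ, IntervalIntegrable (fun s : ℝ => (1 - s ^ 2) ^ (m - 1)) volume c d :=
    fun c d => (Continuous.rpow_const (by fun_prop) fun _ =>
      Or.inr (by linarith)).intervalIntegrable _ _
  have key : ∀ w : ℝ, (∀ s ∈ Icc x y, (1 - s ^ 2) ^ (m - 1) ≤ w) →
      ∫ s in x..y, (1 - s ^ 2) ^ (m - 1) ≤ (y - x) * w := fun w hw => by
    have := intervalIntegral.integral_mono_on hxy.le (hcont x y)
      (intervalIntegrable_const (c := w)) hw
    simpa using this
  have hpos : 0 < (1 - y ^ 2) ^ (-m) := by positivity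
  rcases le_total y 0 with h | h
  · have h1 := key ((1 - y ^ 2) ^ (m - 1)) fun s hs =>
      Real.rpow_le_rpow (by nlinarith [hs.1, hs.2]) (by nlinarith [hs.1, hs.2]) (by linarith)
    have e2 : (1 - y ^ 2) ^ (-m) * (1 - y ^ 2) ^ (m - 1) * (1 - y ^ 2) = 1 := by
      rw [← Real.rpow_add hy0, ← Real.rpow_add_one hy0.ne',
        show -m + (m - 1) + 1 = 0 by ring, Real.rpow_zero]
    have h2 : 1 ≤ (1 - b ^ 2) ^ (-m) := Real.one_le_rpow_of_pos_of_le_one_of_nonpos hb'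
      (by nlinarith) (by linarith)
    have h3 : y - x ≤ 1 - y ^ 2 := by nlinarith
    have h4 := mul_le_mul_of_nonneg_left h1 hpos.le
    have h5 : 0 < (1 - y ^ 2) ^ (-m) * (1 - y ^ 2) ^ (m - 1) := by positivity
    nlinarith
  · have h1 := key 1 fun s hs => Real.rpow_le_one (by nlinarith [hs.1, hs.2])
      (by nlinarith) (by linarith)
    have h2 : (1 - y ^ 2) ^ (-m) ≤ (1 - b ^ 2) ^ (-m) :=
      Real.rpow_le_rpow_of_nonpos hb' (by nlinarith) (by linarith)
    have h3 : ∫ s in x..y, (1 - s ^ 2) ^ (m - 1) ≤ 2 := by linarith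
    calc _ ≤ (1 - y ^ 2) ^ (-m) * 2 := mul_le_mul_of_nonneg_left h3 hpos.le
      _ ≤ _ := by linarith

theorem eq_zero_right (hf : IsProfile m lam μ p f) (hc : Continuous f) (hm : 1 ≤ m)
    (hlam : 0 < lam) (hμ : 0 ≤ μ) (hp : 0 < p) {x : ℝ} (hx : x ∈ Icc (-1 : ℝ) 1) (hfx : f x = 0) :
    ∀ s ∈ Icc x 1, f s = 0 := by
  have hnn := fun s hs => hf.nonneg hc hlam hp (s := s) hs
  refine IsClosed.Icc_subset_of_forall_exists_gt (s := {s | f s = 0})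
    ((isClosed_singleton.preimage hc).inter isClosed_Icc) hfx fun z hz w hw => ?_
  have hfz : f z = 0 := hz.1
  have hz1 : -1 ≤ z := hx.1.trans hz.2.1
  have hz2 : z < 1 := hz.2.2
  have hzw : z < w := hw
  obtain ⟨b, hb1, hb2⟩ := exists_between (max_lt hz2 one_pos)
  have hzb : z < b := (le_max_left _ _).trans_lt hb1
  have hb0 : 0 < b := (le_max_right _ _).trans_lt hb1
  have hb' : 0 < 1 - b ^ 2 := by nlinarith
  set A := lam * (2 * (1 - b ^ 2) ^ (-m)) with hA
  have hA0 : 0 < A := by positivity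
  set c := min (min w b) (z + 1 / (2 * A)) with hcdef
  have hc1 : c ≤ w := (min_le_left _ _).trans (min_le_left _ _)
  have hc2 : c ≤ b := (min_le_left _ _).trans (min_le_right _ _)
  have hc3 : c ≤ z + 1 / (2 * A) := min_le_right _ _
  have hzc : z < c := lt_min (lt_min hzw hzb) (by linarith [show 0 < 1 / (2 * A) by positivity])
  obtain ⟨y, hy, hmax⟩ := isCompact_Icc.exists_isMaxOn (nonempty_Icc.2 hzc.le)
    (hc.continuousOn (s := Icc z c))
  have hS0 : 0 ≤ f y := hnn y ⟨by linarith [hy.1], by linarith [hy.2]⟩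
  have hder : ∀ t ∈ Ioo z y, deriv f t ≤ A * f y := fun t ht => by
    have ht' : t ∈ Ioo (-1 : ℝ) 1 := ⟨by linarith [ht.1], by linarith [ht.2, hy.2]⟩
    rw [hf.deriv_eq_of_isMin ⟨hz1, hz2⟩ (fun s hs => by rw [hfz]; exact hnn s hs) ht']
    have hcont : IntervalIntegrable (fun s : ℝ => (1 - s ^ 2) ^ (m - 1)) volume z t :=
      (Continuous.rpow_const (by fun_prop) fun _ =>
        Or.inr (by linarith)).intervalIntegrable _ _
    have h1 : ∫ s in z..t, source m lam μ p f s ≤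
        ∫ s in z..t, (1 - s ^ 2) ^ (m - 1) * (lam * f y) := by
      refine intervalIntegral.integral_mono_on ht.1.le
        (hf.intervalIntegrable ⟨hz1, hz2.le⟩ (Ioo_subset_Icc_self ht')) (hcont.mul_const _)
        fun s hs => ?_
      refine mul_le_mul_of_nonneg_left ?_
        (Real.rpow_nonneg (by nlinarith [hs.1, hs.2, ht'.2]) _)
      have h2 : 0 ≤ μ * (max (f s) 0) ^ p :=
        mul_nonneg hμ (Real.rpow_nonneg (le_max_right _ _) _)
      have h3 : f s ≤ f y := hmax (a := s) ⟨hs.1, by linarith [hs.2, ht.2, hy.2]⟩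
      nlinarith
    rw [intervalIntegral.integral_mul_const] at h1
    have h2 := weight_ratio_le hm hz1 ht.1 (by linarith [ht.2, hy.2]) hb0.le hb2
    calc _ ≤ (1 - t ^ 2) ^ (-m) * ((∫ s in z..t, (1 - s ^ 2) ^ (m - 1)) * (lam * f y)) :=
          mul_le_mul_of_nonneg_left h1 (Real.rpow_nonneg (one_sub_sq_pos ht').le _)
      _ = ((1 - t ^ 2) ^ (-m) * ∫ s in z..t, (1 - s ^ 2) ^ (m - 1)) * (lam * f y) := by ring
      _ ≤ (2 * (1 - b ^ 2) ^ (-m)) * (lam * f y) :=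
          mul_le_mul_of_nonneg_right h2 (by positivity)
      _ = _ := by rw [hA]; ring
  have h1 := (convex_Icc z y).image_sub_le_mul_sub_of_deriv_le hc.continuousOn
    (fun t ht => by
      rw [interior_Icc] at ht
      exact (hf.hasDerivAt t ⟨by linarith [ht.1],
        by linarith [ht.2, hy.2]⟩).differentiableAt.differentiableWithinAt)
    (fun t ht => hder t (by rwa [interior_Icc] at ht)) z (left_mem_Icc.2 hy.1) y
    (right_mem_Icc.2 hy.1) hy.1
  rw [hfz, sub_zero] at h1
  have h2 : A * (y - z) ≤ 1 / 2 := by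
    have : A * (1 / (2 * A)) = 1 / 2 := by field_simp
    nlinarith [hy.2]
  have h3 : f y = 0 := by nlinarith
  refine ⟨c, le_antisymm ?_ (hnn c ⟨by linarith, by linarith⟩), hzc, hc1⟩
  rw [← h3]
  exact hmax (right_mem_Icc.2 hzc.le)

theorem pos (hf : IsProfile m lam μ p f) (hc : Continuous f) (hm : 1 ≤ m)
    (hlam : 0 < lam) (hμ : 0 ≤ μ) (hp : 0 < p) (hne : ¬ ∃ c, ∀ s ∈ Ioo (-1 : ℝ) 1, f s = c)
    {x : ℝ} (hx : x ∈ Icc (-1 : ℝ) 1) : 0 < f x := by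
  refine lt_of_le_of_ne (hf.nonneg hc hlam hp hx) fun h => hne ⟨0, fun s hs => ?_⟩
  rcases le_total x s with hxs | hxs
  · exact hf.eq_zero_right hc hm hlam hμ hp hx h.symm s ⟨hxs, hs.2.le⟩
  · have := hf.comp_neg.eq_zero_right (x := -x) (hc.comp continuous_neg) hm hlam hμ hp
      ⟨by linarith [hx.2], by linarith [hx.1]⟩ (by simpa using h.symm) (-s)
      ⟨by linarith, by linarith [hs.1]⟩
    simpa using this

end IsProfile

open scoped ContDiff

theorem exists_contDiffOn_primitive {y Z : ℝ → ℝ} {k : ℕ}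
    (hZ : ContDiffOn ℝ k Z (Icc (-1) 1)) (hy : ∀ s ∈ Ioo (-1 : ℝ) 1, HasDerivAt y (Z s) s) :
    ∃ G, ContDiffOn ℝ (k + 1 : ℕ) G (Icc (-1) 1) ∧ EqOn y G (Ioo (-1) 1) := by
  have h11 : (-1 : ℝ) ≤ 1 := by norm_num
  set Zc : ℝ → ℝ := IccExtend h11 ((Icc (-1 : ℝ) 1).domRestrict Z) with hZc
  have hcont : Continuous Zc := hZ.continuousOn.domRestrict.Icc_extend'
  have hZeq : ∀ s ∈ Icc (-1 : ℝ) 1, Zc s = Z s := fun s hs => by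
    rw [hZc, IccExtend_of_mem h11 _ hs]; rfl
  set G : ℝ → ℝ := fun s => y 0 + ∫ t in 0..s, Zc t with hG
  have hGd : ∀ s, HasDerivAt G (Zc s) s := fun s =>
    (hcont.integral_hasStrictDerivAt 0 s).hasDerivAt.const_add (y 0)
  refine ⟨G, ?_, ?_⟩
  · push_cast
    rw [contDiffOn_succ_iff_derivWithin (uniqueDiffOn_Icc (by norm_num))]
    refine ⟨fun s _ => (hGd s).differentiableAt.differentiableWithinAt, by simp, ?_⟩
    refine hZ.congr fun s hs => ?_
    rw [(hGd s).hasDerivWithinAt.derivWithin (uniqueDiffOn_Icc (by norm_num) s hs), hZeq s hs]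
  · have h0 : (0 : ℝ) ∈ Ioo (-1 : ℝ) 1 := by norm_num
    refine isOpen_Ioo.eqOn_of_deriv_eq isPreconnected_Ioo
      (fun s hs => (hy s hs).differentiableAt.differentiableWithinAt)
      (fun s _ => (hGd s).differentiableAt.differentiableWithinAt) (fun s hs => ?_) h0 ?_
    · rw [(hy s hs).deriv, (hGd s).deriv, hZeq s (Ioo_subset_Icc_self hs)]
    · simp [hG]

theorem tendsto_one_sub_sq_rpow_left {a : ℝ} (ha : 0 < a) :
    Tendsto (fun s : ℝ => (1 - s ^ 2) ^ a) (𝓝[<] 1) (𝓝 0) := by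
  have : Continuous fun s : ℝ => (1 - s ^ 2) ^ a :=
    Continuous.rpow_const (by fun_prop) fun _ => Or.inr ha.le
  have h := this.tendsto 1
  simp only [one_pow, sub_self, Real.zero_rpow ha.ne'] at h
  exact h.mono_left nhdsWithin_le_nhds

theorem tendsto_neg_nhdsGT_neg_one : Tendsto (fun s : ℝ => -s) (𝓝[>] (-1)) (𝓝[<] 1) := by
  refine tendsto_nhdsWithin_iff.2 ⟨?_, ?_⟩
  · have := (continuous_neg (G := ℝ)).tendsto (-1)
    rw [neg_neg] at this
    exact this.mono_left nhdsWithin_le_nhds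
  · filter_upwards [self_mem_nhdsWithin] with s hs
    have : -1 < s := hs
    exact mem_Iio.2 (by linarith)

theorem tendsto_neg_nhdsLT_one : Tendsto (fun s : ℝ => -s) (𝓝[<] 1) (𝓝[>] (-1)) := by
  refine tendsto_nhdsWithin_iff.2 ⟨?_, ?_⟩
  · exact ((continuous_neg (G := ℝ)).tendsto 1).mono_left nhdsWithin_le_nhds
  · filter_upwards [self_mem_nhdsWithin] with s hs
    have : s < 1 := hs
    exact mem_Ioi.2 (by linarith)

theorem tendsto_singular_left {a : ℝ} (ha : 0 < a) {y R : ℝ → ℝ}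
    (hR : ContinuousOn R (Icc (-1) 1))
    (hy : ∀ s ∈ Ioo (-1 : ℝ) 1, HasDerivAt y ((2 * a * s * y s + R s) / (1 - s ^ 2)) s)
    (h1 : Tendsto (fun s => (1 - s ^ 2) ^ a * y s) (𝓝[<] 1) (𝓝 0)) :
    Tendsto y (𝓝[<] 1) (𝓝 (R 1 / (a * (-2) * 1))) := by
  have hsub : Ioo (0 : ℝ) 1 ⊆ Ioo (-1 : ℝ) 1 := Ioo_subset_Ioo (by norm_num) le_rfl
  have hIoo : Ioo (-1 : ℝ) 1 ∈ 𝓝[<] (1 : ℝ) := Ioo_mem_nhdsLT (by norm_num)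
  have hR1 : Tendsto R (𝓝[<] 1) (𝓝 (R 1)) :=
    (hR 1 (by norm_num)).mono_left (nhdsWithin_le_iff.2 (mem_of_superset hIoo Ioo_subset_Icc_self))
  have hdiv : Tendsto (fun s => (1 - s ^ 2) ^ (a - 1) * R s /
      (a * (1 - s ^ 2) ^ (a - 1) * (-2 * s))) (𝓝[<] 1) (𝓝 (R 1 / (a * (-2) * 1))) := by
    have h2 : Tendsto (fun s : ℝ => a * (-2) * s) (𝓝[<] 1) (𝓝 (a * (-2) * 1)) :=
      ((continuous_const.mul continuous_id).tendsto 1).mono_left nhdsWithin_le_nhds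
    refine (hR1.div h2 (by linarith)).congr' ?_
    filter_upwards [hIoo] with s hs
    have := Real.rpow_pos_of_pos (one_sub_sq_pos hs) (a - 1)
    rw [show a * (1 - s ^ 2) ^ (a - 1) * (-2 * s) = (1 - s ^ 2) ^ (a - 1) * (a * (-2) * s) by ring,
      mul_div_mul_left _ _ this.ne']
    rfl
  have := HasDerivAt.lhopital_zero_left_on_Ioo (a := (0 : ℝ)) (b := 1) one_pos
    (f := fun s => (1 - s ^ 2) ^ a * y s) (f' := fun s => (1 - s ^ 2) ^ (a - 1) * R s)
    (g := fun s => (1 - s ^ 2) ^ a) (g' := fun s => a * (1 - s ^ 2) ^ (a - 1) * (-2 * s))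
    (fun s hs => ?_) (fun s hs => ?_) (fun s hs => ?_) h1 (tendsto_one_sub_sq_rpow_left ha) hdiv
  · refine this.congr' ?_
    filter_upwards [hIoo] with s hs
    exact mul_div_cancel_left₀ _ (Real.rpow_pos_of_pos (one_sub_sq_pos hs) _).ne'
  · have hs0 := one_sub_sq_pos (hsub hs)
    refine ((hasDerivAt_one_sub_sq_rpow (hsub hs)).mul (hy s (hsub hs))).congr_deriv ?_
    have e : (1 - s ^ 2) ^ a = (1 - s ^ 2) ^ (a - 1) * (1 - s ^ 2) := by
      rw [← Real.rpow_add_one hs0.ne']; congr 1; ring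
    rw [e]
    field_simp
    ring
  · refine (hasDerivAt_one_sub_sq_rpow (hsub hs)).congr_deriv ?_
    ring
  · have := Real.rpow_pos_of_pos (one_sub_sq_pos (hsub hs)) (a - 1)
    have := hs.1
    exact (mul_neg_of_pos_of_neg (by positivity) (by linarith)).ne

theorem exists_continuousOn_singular {a : ℝ} (ha : 0 < a) {y R : ℝ → ℝ}
    (hR : ContinuousOn R (Icc (-1) 1))
    (hy : ∀ s ∈ Ioo (-1 : ℝ) 1, HasDerivAt y ((2 * a * s * y s + R s) / (1 - s ^ 2)) s)
    (h1 : Tendsto (fun s => (1 - s ^ 2) ^ a * y s) (𝓝[<] 1) (𝓝 0))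
    (h2 : Tendsto (fun s => (1 - s ^ 2) ^ a * y s) (𝓝[>] (-1)) (𝓝 0)) :
    ∃ Y, ContinuousOn Y (Icc (-1) 1) ∧ EqOn y Y (Ioo (-1) 1) := by
  have l1 := tendsto_singular_left ha hR hy h1
  have l2 := tendsto_singular_left ha (y := fun s => -y (-s)) (R := fun s => R (-s))
    (hR.comp continuousOn_neg fun s hs => ⟨by linarith [hs.2], by linarith [hs.1]⟩)
    (fun s hs => by
      have := ((hy (-s) ⟨by linarith [hs.2], by linarith [hs.1]⟩).comp s (hasDerivAt_neg s)).neg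
      refine this.congr_deriv ?_
      rw [neg_sq]; ring)
    (by
      have := (h2.comp tendsto_neg_nhdsLT_one).neg
      simpa [Function.comp_def] using this)
  have l3 := (l2.comp tendsto_neg_nhdsGT_neg_one).neg
  simp only [Function.comp_def, neg_neg] at l3
  have hc : ContinuousOn y (Ioo (-1) 1) := fun s hs => (hy s hs).continuousAt.continuousWithinAt
  refine ⟨extendFrom (Ioo (-1) 1) y, ?_, fun s hs => ?_⟩
  · exact continuousOn_Icc_extendFrom_Ioo hc l3 l1
  · exact (extendFrom_eq (subset_closure hs) (hc s hs)).symm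

theorem exists_contDiffOn_singular (k : ℕ) : ∀ {a : ℝ} {y R : ℝ → ℝ}, 0 < a →
    ContDiffOn ℝ k R (Icc (-1) 1) →
    (∀ s ∈ Ioo (-1 : ℝ) 1, HasDerivAt y ((2 * a * s * y s + R s) / (1 - s ^ 2)) s) →
    Tendsto (fun s => (1 - s ^ 2) ^ a * y s) (𝓝[<] 1) (𝓝 0) →
    Tendsto (fun s => (1 - s ^ 2) ^ a * y s) (𝓝[>] (-1)) (𝓝 0) →
    ∃ Y, ContDiffOn ℝ k Y (Icc (-1) 1) ∧ EqOn y Y (Ioo (-1) 1) := by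
  induction k with
  | zero =>
    intro a y R ha hR hy h1 h2
    obtain ⟨Y, hY, hyY⟩ := exists_continuousOn_singular ha hR.continuousOn hy h1 h2
    exact ⟨Y, by simpa using hY, hyY⟩
  | succ k ih =>
    intro a y R ha hR hy h1 h2
    obtain ⟨Y, hY, hyY⟩ := ih ha (hR.of_le (by exact_mod_cast Nat.le_succ k)) hy h1 h2
    have hR' := hR
    push_cast at hR'
    rw [contDiffOn_succ_iff_derivWithin (uniqueDiffOn_Icc (by norm_num))] at hR'
    set z : ℝ → ℝ := fun s => (2 * a * s * y s + R s) / (1 - s ^ 2) with hz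
    have hlim : ∀ (l : Filter ℝ) (c : ℝ), c ∈ Icc (-1 : ℝ) 1 → 1 - c ^ 2 = 0 → l ≤ 𝓝 c →
        Ioo (-1 : ℝ) 1 ∈ l → Tendsto (fun s => (1 - s ^ 2) ^ a * y s) l (𝓝 0) →
        Tendsto (fun s => (1 - s ^ 2) ^ (a + 1) * z s) l (𝓝 0) := fun l c hc hc0 hl hIoo h => by
      have t1 : Tendsto (fun s : ℝ => 2 * a * s) l (𝓝 (2 * a * c)) :=
        ((continuous_const.mul continuous_id).tendsto c).mono_left hl
      have t2 : Tendsto (fun s : ℝ => (1 - s ^ 2) ^ a) l (𝓝 0) := by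
        have : Continuous fun s : ℝ => (1 - s ^ 2) ^ a :=
          Continuous.rpow_const (by fun_prop) fun _ => Or.inr ha.le
        have h := this.tendsto c
        simp only [hc0, Real.zero_rpow ha.ne'] at h
        exact h.mono_left hl
      have t3 : Tendsto R l (𝓝 (R c)) := (hR.continuousOn c hc).mono_left
        (le_inf hl (le_principal_iff.2 (mem_of_superset hIoo Ioo_subset_Icc_self)))
      have t4 := (t1.mul h).add (t2.mul t3)
      rw [mul_zero, zero_mul, add_zero] at t4
      refine t4.congr' ?_
      filter_upwards [hIoo] with s hs
      have hs0 := one_sub_sq_pos hs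
      rw [hz, Real.rpow_add_one hs0.ne']
      field_simp
    obtain ⟨Z, hZ, hzZ⟩ := ih (a := a + 1) (y := z)
      (R := fun s => derivWithin R (Icc (-1) 1) s + 2 * a * Y s) (by linarith)
      (hR'.2.2.add (contDiffOn_const.mul hY)) (fun s hs => by
        have hs0 := one_sub_sq_pos hs
        have hRd : HasDerivAt R (derivWithin R (Icc (-1) 1) s) s :=
          ((hR'.1 s (Ioo_subset_Icc_self hs)).hasDerivWithinAt).hasDerivAt
            (Icc_mem_nhds hs.1 hs.2)
        have hlin : HasDerivAt (fun s : ℝ => 2 * a * s) (2 * a) s := by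
          simpa using (hasDerivAt_id s).const_mul (2 * a)
        have hden : HasDerivAt (fun s : ℝ => 1 - s ^ 2) (-(2 * s)) s := by
          simpa using ((hasDerivAt_id s).pow 2).const_sub 1
        refine (((hlin.mul (hy s hs)).add hRd).div hden hs0.ne').congr_deriv ?_
        rw [← hyY hs]
        simp only [hz, Pi.add_apply, Pi.mul_apply]
        field_simp
        ring)
      (hlim _ 1 (by norm_num) (by norm_num) nhdsWithin_le_nhds (Ioo_mem_nhdsLT (by norm_num)) h1)
      (hlim _ (-1) (by norm_num) (by norm_num) nhdsWithin_le_nhds (Ioo_mem_nhdsGT (by norm_num)) h2)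
    exact exists_contDiffOn_primitive hZ fun s hs => by rw [← hzZ hs]; exact hy s hs

theorem IsProfile.contDiffOn {m lam μ p : ℝ} {f : ℝ → ℝ} (hf : IsProfile m lam μ p f)
    (hc : Continuous f) (hm : 0 < m) (hp : 0 ≤ p) (hpos : ∀ s ∈ Icc (-1 : ℝ) 1, 0 < f s) :
    ContDiffOn ℝ ∞ f (Icc (-1) 1) := by
  have h11 : (-1 : ℝ) ≤ 1 := by norm_num
  rw [contDiffOn_infty]
  intro k
  induction k with
  | zero => simpa using hc.continuousOn
  | succ k ih =>
    have hR : ContDiffOn ℝ k (fun s => lam * f s - μ * (f s) ^ p) (Icc (-1) 1) :=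
      (contDiffOn_const.mul ih).sub
        (contDiffOn_const.mul (ih.rpow_const_of_ne fun s hs => (hpos s hs).ne'))
    have hI : ContinuousOn (fun x => ∫ s in x..1, source m lam μ p f s) (Icc (-1) 1) := by
      have := intervalIntegral.continuousOn_primitive_interval_left (a := (-1 : ℝ)) (b := 1)
        (f := source m lam μ p f) (μ := volume) (by
          rw [uIcc_of_le h11, integrableOn_Icc_iff_integrableOn_Ioc]
          exact (intervalIntegrable_iff_integrableOn_Ioc_of_le h11).1 hf.integrable)
      rwa [uIcc_of_le h11] at this
    have hlim : ∀ (l : Filter ℝ) (c : ℝ), c ∈ Icc (-1 : ℝ) 1 →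
        ∫ s in c..1, source m lam μ p f s = 0 → l ≤ 𝓝 c → Ioo (-1 : ℝ) 1 ∈ l →
        Tendsto (fun s => (1 - s ^ 2) ^ m * deriv f s) l (𝓝 0) := fun l c hc hc0 hl hIoo => by
      have t3 := ((hI c hc).mono_left
        (le_inf hl (le_principal_iff.2 (mem_of_superset hIoo Ioo_subset_Icc_self)))).neg
      simp only [hc0, neg_zero] at t3
      refine t3.congr' ?_
      filter_upwards [hIoo] with s hs
      have hs0 := one_sub_sq_pos hs
      rw [(hf.hasDerivAt s hs).deriv, mul_neg, ← mul_assoc, ← Real.rpow_add hs0,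
        add_neg_cancel, Real.rpow_zero, one_mul]
    obtain ⟨Y, hY, hyY⟩ := exists_contDiffOn_singular k hm hR (y := deriv f)
      (fun s hs => by
        have := hf.hasDerivAt_deriv hp hs
        rwa [max_eq_left (hpos s (Ioo_subset_Icc_self hs)).le] at this)
      (hlim _ 1 (by norm_num) (by simp) nhdsWithin_le_nhds (Ioo_mem_nhdsLT (by norm_num)))
      (hlim _ (-1) (by norm_num) hf.integral_eq_zero nhdsWithin_le_nhds
        (Ioo_mem_nhdsGT (by norm_num)))
    obtain ⟨G, hG, hfG⟩ := exists_contDiffOn_primitive hY fun s hs => by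
      rw [← hyY hs]; exact (hf.hasDerivAt s hs).differentiableAt.hasDerivAt
    refine hG.congr (EqOn.of_subset_closure hfG hc.continuousOn hG.continuousOn
      Ioo_subset_Icc_self ?_)
    rw [closure_Ioo (by norm_num)]

theorem exists_profile {m α p lam : ℝ} (hm : 1 ≤ m) (hα : 0 ≤ α)
    (hmα : m - 1 < 2 * α) (hp : 1 < p) (hpα : (p + 1) * α < m) (hl : 2 * m < lam * (p - 1)) :
    ∃ f : ℝ → ℝ, ContDiffOn ℝ ∞ f (Icc (-1) 1) ∧ (∀ s ∈ Icc (-1 : ℝ) 1, 0 < f s) ∧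
      (¬ ∃ c, ∀ s ∈ Ioo (-1 : ℝ) 1, f s = c) ∧
      ∀ s ∈ Ioo (-1 : ℝ) 1, (1 - s ^ 2) * deriv (deriv f) s - 2 * m * s * deriv f s
        - lam * f s + f s ^ p = 0 := by
  obtain ⟨f, μ, hμ, hc, hf, hne⟩ := exists_continuous_profile hm hα hmα hp hpα hl
  have hlam : 0 < lam := by
    by_contra! h
    nlinarith
  have hpos : ∀ s ∈ Icc (-1 : ℝ) 1, 0 < f s := fun s hs =>
    hf.pos hc hm hlam hμ.le (by linarith) hne hs
  set κ := μ ^ (1 / (p - 1)) with hκ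
  have hκ0 : 0 < κ := Real.rpow_pos_of_pos hμ _
  have hκp : κ ^ p = κ * μ := by
    have : κ ^ (p - 1) = μ := by
      rw [hκ, ← Real.rpow_mul hμ.le, one_div_mul_cancel (by linarith), Real.rpow_one]
    rw [← this, mul_comm, ← Real.rpow_add_one hκ0.ne', sub_add_cancel]
  refine ⟨fun s => κ * f s,
    contDiffOn_const.mul (hf.contDiffOn hc (by linarith) (by linarith) hpos),
    fun s hs => mul_pos hκ0 (hpos s hs), fun ⟨c, h⟩ => hne ⟨c / κ, fun s hs => ?_⟩, fun s hs => ?_⟩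
  · rw [← h s hs]; field_simp
  · have hs0 := one_sub_sq_pos hs
    have d1 : deriv (fun s => κ * f s) = fun s => κ * deriv f s :=
      funext fun s => deriv_const_mul_field κ
    rw [d1, deriv_const_mul_field, (hf.hasDerivAt_deriv (by linarith) hs).deriv,
      Real.mul_rpow hκ0.le (hpos s (Ioo_subset_Icc_self hs)).le, hκp,
      max_eq_left (hpos s (Ioo_subset_Icc_self hs)).le]
    field_simp
    ring

section InnerProduct

variable {E : Type*} [NormedAddCommGroup E] [InnerProductSpace ℝ E]

theorem hasFDerivAt_norm_of_ne_zero {x : E} (hx : x ≠ 0) :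
    HasFDerivAt (fun y : E => ‖y‖) (‖x‖⁻¹ • innerSL ℝ x) x := by
  have hx' : ‖x‖ ≠ 0 := norm_ne_zero_iff.2 hx
  have h := (hasStrictFDerivAt_norm_sq x).hasFDerivAt.sqrt (pow_ne_zero 2 hx')
  simp only [Real.sqrt_sq (norm_nonneg _)] at h
  refine h.congr_fderiv ?_
  ext v
  simp
  field_simp

theorem hasFDerivAt_inner_div_norm (e : E) {x : E} (hx : x ≠ 0) :
    HasFDerivAt (fun y : E => ⟪e, y⟫_ℝ / ‖y‖)
      (‖x‖⁻¹ • innerSL ℝ e - (⟪e, x⟫_ℝ / ‖x‖ * (‖x‖ ^ 2)⁻¹) • innerSL ℝ x) x := by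
  have hx' : ‖x‖ ≠ 0 := norm_ne_zero_iff.2 hx
  have h := (innerSL ℝ e).hasFDerivAt (x := x) |>.mul
    ((hasDerivAt_inv hx').comp_hasFDerivAt x (hasFDerivAt_norm_of_ne_zero hx))
  simp only [innerSL_apply_apply] at h
  refine h.congr_fderiv ?_
  ext v
  simp
  field_simp
  ring

theorem hasFDerivAt_norm_rpow_mul_comp (e : E) {x : E} (hx : x ≠ 0) (μ : ℝ) {g : ℝ → ℝ} {g' : ℝ}
    (hg : HasDerivAt g g' (⟪e, x⟫_ℝ / ‖x‖)) :
    HasFDerivAt (fun y : E => ‖y‖ ^ (-μ) * g (⟪e, y⟫_ℝ / ‖y‖))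
      ((-(‖x‖ ^ (-(μ + 2)) * (μ * g (⟪e, x⟫_ℝ / ‖x‖) + ⟪e, x⟫_ℝ / ‖x‖ * g'))) • innerSL ℝ x
        + (‖x‖ ^ (-(μ + 1)) * g') • innerSL ℝ e) x := by
  have hx' : 0 < ‖x‖ := norm_pos_iff.2 hx
  have h := ((Real.hasDerivAt_rpow_const (p := -μ) (Or.inl hx'.ne')).comp_hasFDerivAt x
    (hasFDerivAt_norm_of_ne_zero hx)).mul
    (hg.comp_hasFDerivAt x (hasFDerivAt_inner_div_norm e hx))
  refine h.congr_fderiv ?_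
  ext v
  have e1 : ‖x‖ ^ (-μ) = ‖x‖ ^ (-(μ + 2)) * ‖x‖ ^ 2 := by
    rw [← Real.rpow_natCast, ← Real.rpow_add hx']; congr 1; push_cast; ring
  have e2 : ‖x‖ ^ (-(μ + 1)) = ‖x‖ ^ (-(μ + 2)) * ‖x‖ := by
    rw [← Real.rpow_add_one hx'.ne']; congr 1; ring
  have e3 : ‖x‖ ^ (-μ - 1) = ‖x‖ ^ (-(μ + 2)) * ‖x‖ := by
    rw [← e2]; congr 1; ring
  simp [-neg_add_rev, e1, e2, e3]
  field_simp
  ring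

theorem inner_div_norm_mem_Icc {e : E} (he : ‖e‖ = 1) (x : E) :
    ⟪e, x⟫_ℝ / ‖x‖ ∈ Icc (-1 : ℝ) 1 := by
  have h := abs_real_inner_div_norm_mul_norm_le_one e x
  rw [he, one_mul] at h
  exact abs_le.1 h

theorem inner_div_norm_mem_Ioo {e x : E} (he : ‖e‖ = 1) (hx : x ∉ ℝ ∙ e) :
    ⟪e, x⟫_ℝ / ‖x‖ ∈ Ioo (-1 : ℝ) 1 := by
  refine abs_lt.1 (lt_of_le_of_ne (abs_le.2 (inner_div_norm_mem_Icc he x)) fun h => hx ?_)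
  have h' := abs_real_inner_div_norm_mul_norm_eq_one_iff e x
  rw [he, one_mul] at h'
  obtain ⟨-, r, -, rfl⟩ := h'.1 h
  exact Submodule.smul_mem _ _ (Submodule.mem_span_singleton_self e)

theorem contDiffOn_norm_rpow_mul_comp {e : E} (he : ‖e‖ = 1) (μ : ℝ) {f : ℝ → ℝ}
    (hf : ContDiffOn ℝ ∞ f (Icc (-1) 1)) :
    ContDiffOn ℝ ∞ (fun y : E => ‖y‖ ^ (-μ) * f (⟪e, y⟫_ℝ / ‖y‖)) {x | x ≠ 0} := by
  have hn : ContDiffOn ℝ ∞ (fun y : E => ‖y‖) {x | x ≠ 0} := contDiffOn_id.norm ℝ fun x hx => hx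
  refine (hn.rpow_const_of_ne fun x hx => norm_ne_zero_iff.2 hx).mul (hf.comp ?_ fun x _ =>
    inner_div_norm_mem_Icc he x)
  exact (contDiffOn_const.inner ℝ contDiffOn_id).div hn fun x hx => norm_ne_zero_iff.2 hx

end InnerProduct

theorem eLaplacian_eq_of_hasFDerivAt {n : ℕ} {u A B : EuclideanSpace ℝ (Fin n) → ℝ}
    {A' B' : EuclideanSpace ℝ (Fin n) →L[ℝ] ℝ} {e x : EuclideanSpace ℝ (Fin n)}
    (hu : ∀ᶠ y in 𝓝 x, HasFDerivAt u (A y • innerSL ℝ y + B y • innerSL ℝ e) y)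
    (hA : HasFDerivAt A A' x) (hB : HasFDerivAt B B' x) :
    eLaplacian u x = n * A x + A' x + B' e := by
  have h1 : fderiv ℝ u =ᶠ[𝓝 x] fun y => A y • innerSL ℝ y + B y • innerSL ℝ e :=
    hu.mono fun y hy => hy.fderiv
  have h2 := (hA.smul (innerSL ℝ (E := EuclideanSpace ℝ (Fin n))).hasFDerivAt).add
    (hB.smul_const (innerSL ℝ e))
  have h3 : fderiv ℝ (fderiv ℝ u) x = _ := h1.fderiv_eq.trans h2.fderiv
  have hsum : ∀ (L : EuclideanSpace ℝ (Fin n) →L[ℝ] ℝ) (z : EuclideanSpace ℝ (Fin n)),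
      ∑ i, L (EuclideanSpace.single i 1) * z i = L z := fun L z => by
    conv_rhs => rw [← (EuclideanSpace.basisFun (Fin n) ℝ).sum_repr z, map_sum]
    simp [mul_comm]
  have h4 : ∀ i, iteratedFDeriv ℝ 2 u x ![EuclideanSpace.single i 1, EuclideanSpace.single i 1]
      = A x + A' (EuclideanSpace.single i 1) * x i + B' (EuclideanSpace.single i 1) * e i := by
    intro i
    have h5 : ∀ v w, fderiv ℝ (fderiv ℝ u) x v w
        = A x * ⟪v, w⟫_ℝ + A' v * ⟪x, w⟫_ℝ + B' v * ⟪e, w⟫_ℝ := fun v w => by rw [h3]; rfl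
    rw [iteratedFDeriv_two_apply, h5]
    simp [EuclideanSpace.inner_single_right]
  rw [eLaplacian, Finset.sum_congr rfl fun i _ => h4 i, Finset.sum_add_distrib,
    Finset.sum_add_distrib, hsum, hsum]
  simp

theorem continuousAt_eLaplacian {n : ℕ} {u : EuclideanSpace ℝ (Fin n) → ℝ}
    {x : EuclideanSpace ℝ (Fin n)} (hu : ContDiffAt ℝ ∞ u x) : ContinuousAt (eLaplacian u) x := by
  have h : ContinuousAt (iteratedFDeriv ℝ 2 u) x :=
    (hu.iteratedFDeriv_right (m := 0) (i := 2) (by norm_cast)).continuousAt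
  unfold eLaplacian
  refine tendsto_finsetSum _ fun i _ => ?_
  exact ((ContinuousMultilinearMap.apply ℝ (fun _ : Fin 2 => EuclideanSpace ℝ (Fin n)) ℝ
    ![EuclideanSpace.single i 1, EuclideanSpace.single i 1]).continuous.tendsto _).comp h

theorem dense_compl_span_singleton {n : ℕ} (hn : 2 ≤ n) (e : EuclideanSpace ℝ (Fin n)) :
    Dense ((ℝ ∙ e : Submodule ℝ (EuclideanSpace ℝ (Fin n))) : Set (EuclideanSpace ℝ (Fin n)))ᶜ := by
  rw [← interior_eq_empty_iff_dense_compl, ← not_nonempty_iff_eq_empty]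
  intro h
  have h1 := Submodule.eq_top_of_nonempty_interior' _ h
  have h2 := finrank_span_le_card (R := ℝ) {e}
  rw [h1, finrank_top, finrank_euclideanSpace_fin, toFinset_singleton,
    Finset.card_singleton] at h2
  omega

theorem eLaplacian_norm_rpow_mul_comp {n : ℕ} {e x : EuclideanSpace ℝ (Fin n)} (he : ‖e‖ = 1)
    (hx : x ∉ ℝ ∙ e) {κ : ℝ} (hκ : 2 * κ = n - 2) {f : ℝ → ℝ}
    (hf : ContDiffOn ℝ ∞ f (Ioo (-1) 1)) :
    eLaplacian (fun y => ‖y‖ ^ (-κ) * f (⟪e, y⟫_ℝ / ‖y‖)) x =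
      ‖x‖ ^ (-(κ + 2)) * ((1 - (⟪e, x⟫_ℝ / ‖x‖) ^ 2) * deriv (deriv f) (⟪e, x⟫_ℝ / ‖x‖)
        - (2 * κ + 1) * (⟪e, x⟫_ℝ / ‖x‖) * deriv f (⟪e, x⟫_ℝ / ‖x‖)
        - κ ^ 2 * f (⟪e, x⟫_ℝ / ‖x‖)) := by
  have hne : ∀ y ∉ ℝ ∙ e, y ≠ 0 := fun y hy h => hy (h ▸ Submodule.zero_mem _)
  have hx0 := norm_pos_iff.2 (hne x hx)
  have hd : ∀ s ∈ Ioo (-1 : ℝ) 1, HasDerivAt f (deriv f s) s := fun s hs =>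
    ((hf.contDiffAt (Ioo_mem_nhds hs.1 hs.2)).differentiableAt (by simp)).hasDerivAt
  have hf' : ContDiffOn ℝ ∞ (deriv f) (Ioo (-1) 1) := hf.deriv_of_isOpen isOpen_Ioo (by simp)
  have hs := inner_div_norm_mem_Ioo he hx
  have hd' : HasDerivAt (deriv f) (deriv (deriv f) (⟪e, x⟫_ℝ / ‖x‖)) (⟪e, x⟫_ℝ / ‖x‖) :=
    ((hf'.contDiffAt (Ioo_mem_nhds hs.1 hs.2)).differentiableAt (by simp)).hasDerivAt
  have hopen : ∀ᶠ y in 𝓝 x, y ∉ ℝ ∙ e :=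
    (Submodule.closed_of_finiteDimensional (ℝ ∙ e)).isOpen_compl.mem_nhds hx
  have hA := (hasFDerivAt_norm_rpow_mul_comp e (hne x hx) (κ + 2)
    (g := fun s => κ * f s + s * deriv f s)
    (((hd _ hs).const_mul κ).add ((hasDerivAt_id _).mul hd'))).neg
  have hB := hasFDerivAt_norm_rpow_mul_comp e (hne x hx) (κ + 1) hd'
  rw [eLaplacian_eq_of_hasFDerivAt (hopen.mono fun y hy =>
    hasFDerivAt_norm_rpow_mul_comp e (hne y hy) κ (hd _ (inner_div_norm_mem_Ioo he hy))) hA hB]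
  have e1 : ‖x‖ ^ (-(κ + 2)) = ‖x‖ ^ (-(κ + 4)) * ‖x‖ ^ 2 := by
    rw [← Real.rpow_natCast, ← Real.rpow_add hx0]; congr 1; push_cast; ring
  have e2 : ‖x‖ ^ (-(κ + 2 + 1)) = ‖x‖ ^ (-(κ + 4)) * ‖x‖ := by
    rw [← Real.rpow_add_one hx0.ne']; congr 1; ring
  have e3 : ‖x‖ ^ (-(κ + 1 + 2)) = ‖x‖ ^ (-(κ + 4)) * ‖x‖ := by
    rw [← e2]; congr 1; ring
  have e4 : ‖x‖ ^ (-(κ + 1 + 1)) = ‖x‖ ^ (-(κ + 4)) * ‖x‖ ^ 2 := by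
    rw [← e1]; congr 1; ring
  have e5 : ‖x‖ ^ (-(κ + 2 + 2)) = ‖x‖ ^ (-(κ + 4)) := by
    congr 1; ring
  have hn : (n : ℝ) = 2 * κ + 2 := by linarith
  have hex : ⟪x, e⟫_ℝ = ⟪e, x⟫_ℝ := real_inner_comm _ _
  simp [-neg_add_rev, e1, e2, e3, e4, e5, hn, hex, he]
  field_simp
  ring

theorem exists_norm_eq_one_inner_eq {n : ℕ} (hn : 2 ≤ n) {e : EuclideanSpace ℝ (Fin n)}
    (he : ‖e‖ = 1) {s : ℝ} (hs : s ∈ Icc (-1 : ℝ) 1) :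
    ∃ x : EuclideanSpace ℝ (Fin n), ‖x‖ = 1 ∧ ⟪e, x⟫_ℝ = s := by
  have hr : 1 < Module.rank ℝ (EuclideanSpace ℝ (Fin n)) := by
    rw [← Module.finrank_eq_rank, finrank_euclideanSpace_fin]
    exact_mod_cast hn
  have hc : ContinuousOn (fun x : EuclideanSpace ℝ (Fin n) => ⟪e, x⟫_ℝ)
    (Metric.sphere (0 : EuclideanSpace ℝ (Fin n)) 1) := by fun_prop
  obtain ⟨x, hx, hxs⟩ :=
    (isPreconnected_sphere hr (0 : EuclideanSpace ℝ (Fin n)) 1).intermediate_value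
    (a := -e) (b := e) (by simp [he]) (by simp [he]) hc (by simpa [he] using hs)
  exact ⟨x, by simpa using hx, hxs⟩

theorem isNonRadialSolution_of_profile {n : ℕ} (hn : 3 ≤ n) {c κ p : ℝ} (hκ : 2 * κ = n - 2)
    (hp : p = ((n : ℝ) + 2) / ((n : ℝ) - 2)) {f : ℝ → ℝ} (hf : ContDiffOn ℝ ∞ f (Icc (-1) 1))
    (hpos : ∀ s ∈ Icc (-1 : ℝ) 1, 0 < f s) (hne : ¬ ∃ c, ∀ s ∈ Ioo (-1 : ℝ) 1, f s = c)
    (hode : ∀ s ∈ Ioo (-1 : ℝ) 1, (1 - s ^ 2) * deriv (deriv f) s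
      - (2 * κ + 1) * s * deriv f s - (κ ^ 2 - c) * f s + f s ^ p = 0)
    {e : EuclideanSpace ℝ (Fin n)} (he : ‖e‖ = 1) :
    IsNonRadialSolution n c (fun y => ‖y‖ ^ (-κ) * f (⟪e, y⟫_ℝ / ‖y‖)) := by
  have hn' : (3 : ℝ) ≤ n := by exact_mod_cast hn
  have hsmooth := contDiffOn_norm_rpow_mul_comp he κ hf
  have hupos : ∀ x : EuclideanSpace ℝ (Fin n), x ≠ 0 →
      0 < ‖x‖ ^ (-κ) * f (⟪e, x⟫_ℝ / ‖x‖) := fun x hx =>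
    mul_pos (Real.rpow_pos_of_pos (norm_pos_iff.2 hx) _) (hpos _ (inner_div_norm_mem_Icc he x))
  refine ⟨hsmooth, hupos, fun x hx => ?_, fun h => ?_⟩
  · rw [← hp]
    have hat : ContDiffAt ℝ ∞ (fun y : EuclideanSpace ℝ (Fin n) =>
        ‖y‖ ^ (-κ) * f (⟪e, y⟫_ℝ / ‖y‖)) x := hsmooth.contDiffAt (isOpen_ne.mem_nhds hx)
    have hcont : ContinuousAt (fun x => eLaplacian (fun y : EuclideanSpace ℝ (Fin n) =>
        ‖y‖ ^ (-κ) * f (⟪e, y⟫_ℝ / ‖y‖)) x + (c / ‖x‖ ^ 2) * (‖x‖ ^ (-κ) * f (⟪e, x⟫_ℝ / ‖x‖))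
        + (‖x‖ ^ (-κ) * f (⟪e, x⟫_ℝ / ‖x‖)) ^ p) x :=
      ((continuousAt_eLaplacian hat).add (
        (continuousAt_const.div (continuous_norm.continuousAt.pow 2)
        (pow_ne_zero 2 (norm_ne_zero_iff.2 hx))).mul hat.continuousAt)).add
        (hat.continuousAt.rpow_const (Or.inl (hupos x hx).ne'))
    have hfreq : ∃ᶠ y in 𝓝 x, y ∉ ℝ ∙ e :=
      mem_closure_iff_frequently.1 (dense_compl_span_singleton (by omega) e x)
    by_contra hF
    obtain ⟨y, hy, hFy⟩ := (hfreq.and_eventually (hcont.eventually_ne hF)).exists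
    apply hFy
    have hy0 : y ≠ 0 := fun h => hy (h ▸ Submodule.zero_mem _)
    have hr := norm_pos_iff.2 hy0
    rw [eLaplacian_norm_rpow_mul_comp he hy hκ (hf.mono Ioo_subset_Icc_self),
      Real.mul_rpow (Real.rpow_nonneg hr.le _) (hpos _ (inner_div_norm_mem_Icc he y)).le,
      ← Real.rpow_mul hr.le]
    have e1 : -κ * p = -(κ + 2) := by
      have : (n : ℝ) - 2 ≠ 0 := by linarith
      rw [hp, show κ = ((n : ℝ) - 2) / 2 by linarith]
      field_simp
      ring
    have e2 : ‖y‖ ^ (-κ) = ‖y‖ ^ (-(κ + 2)) * ‖y‖ ^ 2 := by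
      rw [← Real.rpow_natCast, ← Real.rpow_add hr]; congr 1; push_cast; ring
    have e3 : c / ‖y‖ ^ 2 * (‖y‖ ^ (-(κ + 2)) * ‖y‖ ^ 2 * f (⟪e, y⟫_ℝ / ‖y‖))
        = ‖y‖ ^ (-(κ + 2)) * (c * f (⟪e, y⟫_ℝ / ‖y‖)) := by field_simp
    rw [e1, e2, e3]
    linear_combination ‖y‖ ^ (-(κ + 2)) * hode _ (inner_div_norm_mem_Ioo he hy)
  · have key : ∀ s ∈ Icc (-1 : ℝ) 1, f s = f 1 := fun s hs => by
      obtain ⟨x, hx, hxs⟩ := exists_norm_eq_one_inner_eq (by omega) he hs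
      have := h x e (norm_ne_zero_iff.1 (by simp [hx])) (norm_ne_zero_iff.1 (by simp [he]))
        (hx.trans he.symm)
      simpa [hx, hxs, he] using this
    exact hne ⟨f 1, fun s hs => key s (Ioo_subset_Icc_self hs)⟩

theorem exists_isNonRadialSolution_family {n : ℕ} (hn : 3 ≤ n) {c : ℝ}
    (hc : c < -((n : ℝ) - 2) / 4) (k : ℕ) :
    ∃ u : Fin k → (EuclideanSpace ℝ (Fin n) → ℝ),
      Function.Injective u ∧ ∀ i : Fin k, IsNonRadialSolution n c (u i) := by
  have hn' : (3 : ℝ) ≤ n := by exact_mod_cast hn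
  have hn2 : (0 : ℝ) < n - 2 := by linarith
  obtain ⟨f, hf, hpos, hne, hode⟩ := exists_profile (m := ((n : ℝ) - 1) / 2)
    (α := ((n : ℝ) - 3) / 4 + 1 / (4 * n)) (p := ((n : ℝ) + 2) / (n - 2))
    (lam := (((n : ℝ) - 2) / 2) ^ 2 - c) (by linarith)
    (add_nonneg (by linarith) (by positivity))
    (by have : (0 : ℝ) < 1 / (4 * n) := by positivity
        linarith)
    (by rw [lt_div_iff₀ hn2]; linarith)
    (by rw [div_add_one hn2.ne', div_mul_eq_mul_div, div_lt_iff₀ hn2]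
        field_simp
        nlinarith)
    (by rw [div_sub_one hn2.ne', ← sub_pos]
        have : 0 < (-((n : ℝ) - 2) / 4 - c) * (((n : ℝ) + 2 - (n - 2)) / (n - 2)) :=
          mul_pos (by linarith) (div_pos (by linarith) hn2)
        refine this.trans_eq ?_
        field_simp
        ring)
  have hinf : (f '' Ioo (-1 : ℝ) 1).Infinite := by
    refine
      (isPreconnected_Ioo.image f (hf.continuousOn.mono Ioo_subset_Icc_self)).infinite_of_nontrivial ?_
    by_contra h
    have h0 : (0 : ℝ) ∈ Ioo (-1 : ℝ) 1 := by norm_num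
    exact hne ⟨f 0, fun s hs => not_nontrivial_iff.1 h
      (mem_image_of_mem f hs) (mem_image_of_mem f h0)⟩
  set a : EuclideanSpace ℝ (Fin n) := EuclideanSpace.single ⟨0, by omega⟩ 1 with ha
  have ha1 : ‖a‖ = 1 := by simp [ha]
  choose s hs hfs using fun i : Fin k => (hinf.natEmbedding _ i).2
  choose e he hes using fun i : Fin k =>
    exists_norm_eq_one_inner_eq (by omega) ha1 (Ioo_subset_Icc_self (hs i))
  refine ⟨fun i y => ‖y‖ ^ (-(((n : ℝ) - 2) / 2)) * f (⟪e i, y⟫_ℝ / ‖y‖), fun i j hij => ?_,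
    fun i => isNonRadialSolution_of_profile hn (by ring) rfl hf hpos hne (fun t ht => ?_) (he i)⟩
  · have := congrFun hij a
    simp only [ha1, Real.one_rpow, div_one, one_mul] at this
    rw [real_inner_comm, hes, real_inner_comm, hes, hfs, hfs] at this
    exact Fin.ext ((hinf.natEmbedding _).injective (Subtype.ext this))
  · rw [← hode t ht]; ring

end ProfileEquation

theorem stmt3 (n : ℕ) (hn : 3 ≤ n) :
    (∀ c : ℝ, c < -((n : ℝ) - 2) / 4 →
      ∃ u : EuclideanSpace ℝ (Fin n) → ℝ, IsNonRadialSolution n c u) ∧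
    (∀ k : ℕ, 0 < k → ∃ ck : ℝ, ck < 0 ∧ ∀ c : ℝ, c < ck →
      ∃ u : Fin k → (EuclideanSpace ℝ (Fin n) → ℝ),
        Function.Injective u ∧ ∀ i : Fin k, IsNonRadialSolution n c (u i)) := by
  have hn' : (3 : ℝ) ≤ n := by exact_mod_cast hn
  refine ⟨fun c hc => ?_, fun k _ => ⟨-((n : ℝ) - 2) / 4, by linarith, fun c hc =>
    exists_isNonRadialSolution_family hn hc k⟩⟩
  obtain ⟨u, -, hu⟩ := exists_isNonRadialSolution_family hn hc 1
  exact ⟨u 0, hu 0⟩
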